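/- arXiv:1104.4631 — 2 statements merged into one kernel-verified Lean document; each statement's English description precedes it below -/
import Mathlib

section
/- Let μ and ν be finite positive Borel measures on ℝⁿ with the same total mass. Then W₂(μ, ν) ≤ 2‖ν − μ‖_{Ḣ⁻¹(μ)}. -/
open MeasureTheory ENNReal

/-- The homogeneous Sobolev norm `‖ν − μ‖_{Ḣ⁻¹(lam)}` of the difference of two
finite positive Borel measures `μ, ν` on `ℝⁿ`, with respect to a base measure `lam`:
the supremum of `|∫ f dν − ∫ f dμ|` over bounded `C¹` functions `f` with
`∫ ‖∇f‖² dlam ≤ 1`, valued in `[0,∞]`. -/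
noncomputable def HminusOneDiff {n : ℕ} (lam μ ν : Measure (EuclideanSpace ℝ (Fin n))) :
    ℝ≥0∞ :=
  ⨆ f ∈ {f : EuclideanSpace ℝ (Fin n) → ℝ |
      (∃ C, ∀ x, |f x| ≤ C) ∧ ContDiff ℝ 1 f ∧
      ∫⁻ x, ENNReal.ofReal (‖gradient f x‖ ^ 2) ∂lam ≤ 1},
    ENNReal.ofReal |(∫ x, f x ∂ν) - ∫ x, f x ∂μ|

/-- The quadratic Wasserstein distance `W₂(μ,ν)`, valued in `[0,∞]`. -/
noncomputable def W2 {n : ℕ} (μ ν : Measure (EuclideanSpace ℝ (Fin n))) : ℝ≥0∞ :=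
  (⨅ π ∈ {π : Measure (EuclideanSpace ℝ (Fin n) × EuclideanSpace ℝ (Fin n)) |
      π.map Prod.fst = μ ∧ π.map Prod.snd = ν},
    ∫⁻ p, ENNReal.ofReal (‖p.1 - p.2‖ ^ 2) ∂π) ^ (1/2 : ℝ)


section Semiconcave

variable {E : Type*} [NormedAddCommGroup E] [InnerProductSpace ℝ E]

/-- `g` is semiconcave with constant `L`: along segments it lies below its chords by at most
`L / 2 * t * (1 - t) * ‖y - x‖ ^ 2`. -/
def IsSemiconcave (L : ℝ) (g : E → ℝ) : Prop :=
  ∀ x y : E, ∀ t : ℝ, 0 ≤ t → t ≤ 1 →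
    (1 - t) * g x + t * g y ≤ g (x + t • (y - x)) + L / 2 * (t * (1 - t)) * ‖y - x‖ ^ 2

lemma IsSemiconcave.mono {L L' : ℝ} {g : E → ℝ} (hg : IsSemiconcave L g) (h : L ≤ L') :
    IsSemiconcave L' g := by
  intro x y t h0 h1
  refine (hg x y t h0 h1).trans ?_
  have : 0 ≤ t * (1 - t) := mul_nonneg h0 (by linarith)
  gcongr

lemma IsSemiconcave.abs_sub_le {L B : ℝ} {g : E → ℝ} (hg : IsSemiconcave L g) (hL : 0 ≤ L)
    (hB : ∀ x, |g x| ≤ B) (x y : E) : |g x - g y| ≤ (2 * B + L / 2) * ‖x - y‖ := by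
  have key : ∀ x y : E, g x - g y ≤ (2 * B + L / 2) * ‖y - x‖ := by
    intro x y
    have hx := abs_le.1 (hB x)
    have hy := abs_le.1 (hB y)
    have hB0 : 0 ≤ B := (abs_nonneg _).trans (hB x)
    rcases eq_or_ne x y with rfl | hxy
    · simp
    have hd : 0 < ‖y - x‖ := norm_pos_iff.2 (sub_ne_zero.2 hxy.symm)
    rcases le_total ‖y - x‖ 1 with h1 | h1
    · set d := ‖y - x‖ with hddef
      have h := hg x (x + d⁻¹ • (y - x)) d hd.le h1
      have e1 : x + d • (x + d⁻¹ • (y - x) - x) = y := by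
        rw [add_sub_cancel_left, smul_smul, mul_inv_cancel₀ hd.ne', one_smul]
        abel
      have e2 : ‖x + d⁻¹ • (y - x) - x‖ = 1 := by
        rw [add_sub_cancel_left, norm_smul, ← hddef, Real.norm_of_nonneg (inv_nonneg.2 hd.le),
          inv_mul_cancel₀ hd.ne']
      rw [e1, e2] at h
      have hz := abs_le.1 (hB (x + d⁻¹ • (y - x)))
      nlinarith [mul_nonneg hL hd.le, mul_nonneg hL (mul_nonneg hd.le hd.le)]
    · nlinarith
  rw [abs_le]
  have h1 := key x y
  have h2 := key y x
  rw [norm_sub_rev] at h1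
  constructor <;> linarith

lemma IsSemiconcave.continuous {L B : ℝ} {g : E → ℝ} (hg : IsSemiconcave L g) (hL : 0 ≤ L)
    (hB : ∀ x, |g x| ≤ B) : Continuous g := by
  have : LipschitzWith (Real.toNNReal (2 * B + L / 2)) g := by
    refine LipschitzWith.of_dist_le' fun x y => ?_
    rw [dist_eq_norm, dist_eq_norm]
    exact hg.abs_sub_le hL hB x y
  exact this.continuous

lemma IsSemiconcave.le_add_fderiv {L : ℝ} {g : E → ℝ} (hg : IsSemiconcave L g) {x : E}
    (hd : DifferentiableAt ℝ g x) (h : E) :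
    g (x + h) ≤ g x + fderiv ℝ g x h + L / 2 * ‖h‖ ^ 2 := by
  have hline : HasDerivAt (fun t : ℝ => g (x + t • h)) (fderiv ℝ g x h) 0 :=
    hd.hasFDerivAt.hasLineDerivAt h
  have hlim := hline.tendsto_slope_zero_right
  have hlim2 : Filter.Tendsto (fun t : ℝ => g (x + h) - g x - L / 2 * (1 - t) * ‖h‖ ^ 2)
      (nhdsWithin 0 (Set.Ioi 0)) (nhds (g (x + h) - g x - L / 2 * (1 - 0) * ‖h‖ ^ 2)) := by
    refine Filter.Tendsto.mono_left ?_ nhdsWithin_le_nhds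
    exact Continuous.tendsto (by fun_prop) _
  have hle := le_of_tendsto_of_tendsto hlim2 hlim ?_
  · linarith
  · have hI : Set.Ioo (0 : ℝ) 1 ∈ nhdsWithin (0 : ℝ) (Set.Ioi 0) := Ioo_mem_nhdsGT one_pos
    filter_upwards [hI] with t ht
    have h0 := hg x (x + h) t ht.1.le ht.2.le
    rw [add_sub_cancel_left] at h0
    simp only [zero_add, zero_smul, add_zero, smul_eq_mul]
    rw [inv_mul_eq_div, le_div_iff₀ ht.1]
    nlinarith

end Semiconcave

section InfConvolution

variable {E : Type*} [NormedAddCommGroup E]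

/-- The Hopf-Lax semigroup: `infConv t φ x = inf_w φ w + ‖x - w‖² / (2t)`. -/
noncomputable def infConv (t : ℝ) (φ : E → ℝ) (x : E) : ℝ :=
  ⨅ w, (φ w + ‖x - w‖ ^ 2 / (2 * t))

variable {φ : E → ℝ} {B t : ℝ}

lemma infConv_le (hφ : ∀ x, |φ x| ≤ B) (ht : 0 < t) (x w : E) :
    infConv t φ x ≤ φ w + ‖x - w‖ ^ 2 / (2 * t) := by
  refine ciInf_le ⟨-B, ?_⟩ w
  rintro _ ⟨w, rfl⟩
  have := (abs_le.1 (hφ w)).1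
  have : 0 ≤ ‖x - w‖ ^ 2 / (2 * t) := by positivity
  dsimp only
  linarith

lemma le_infConv {c : ℝ} {x : E} (h : ∀ w, c ≤ φ w + ‖x - w‖ ^ 2 / (2 * t)) :
    c ≤ infConv t φ x := le_ciInf h

lemma infConv_le_self (hφ : ∀ x, |φ x| ≤ B) (ht : 0 < t) (x : E) : infConv t φ x ≤ φ x := by
  simpa using infConv_le hφ ht x x

lemma abs_infConv_le (hφ : ∀ x, |φ x| ≤ B) (ht : 0 < t) (x : E) : |infConv t φ x| ≤ B := by
  refine abs_le.2 ⟨le_infConv fun w => ?_,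
    (infConv_le_self hφ ht x).trans (abs_le.1 (hφ x)).2⟩
  have := (abs_le.1 (hφ w)).1
  have : 0 ≤ ‖x - w‖ ^ 2 / (2 * t) := by positivity
  linarith

lemma norm_sub_sq_div_add_le {s t : ℝ} (hs : 0 < s) (ht : 0 < t) (x y w : E) :
    ‖x - w‖ ^ 2 / (2 * (t + s)) ≤ ‖y - w‖ ^ 2 / (2 * t) + ‖x - y‖ ^ 2 / (2 * s) := by
  have h1 : ‖x - w‖ ≤ ‖y - w‖ + ‖x - y‖ := by
    have := norm_add_le (y - w) (x - y)
    rwa [show y - w + (x - y) = x - w by abel] at this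
  have h2 : ‖x - w‖ ^ 2 ≤ (‖y - w‖ + ‖x - y‖) ^ 2 := by gcongr
  rw [div_add_div _ _ (by positivity) (by positivity), div_le_div_iff₀ (by positivity)
    (by positivity)]
  set a := ‖y - w‖
  set b := ‖x - y‖
  have : (a + b) ^ 2 * (t * s) ≤ (a ^ 2 * s + b ^ 2 * t) * (t + s) := by
    nlinarith [sq_nonneg (a * s - b * t)]
  nlinarith [mul_le_mul_of_nonneg_right h2 (mul_pos ht hs).le]

lemma infConv_add_le (hφ : ∀ x, |φ x| ≤ B) {s : ℝ} (hs : 0 < s) (ht : 0 < t) (x y : E) :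
    infConv (t + s) φ x ≤ infConv t φ y + ‖x - y‖ ^ 2 / (2 * s) := by
  rw [← sub_le_iff_le_add]
  refine le_infConv fun w => ?_
  have h1 := infConv_le hφ (add_pos ht hs) x w
  have h2 := norm_sub_sq_div_add_le hs ht x y w
  linarith

lemma isSemiconcave_infConv [InnerProductSpace ℝ E] (hφ : ∀ x, |φ x| ≤ B) (ht : 0 < t) :
    IsSemiconcave t⁻¹ (infConv t φ) := by
  intro x y r h0 h1
  rw [← sub_le_iff_le_add]
  refine le_infConv fun w => ?_
  have hx := mul_le_mul_of_nonneg_left (infConv_le hφ ht x w) (sub_nonneg.2 h1)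
  have hy := mul_le_mul_of_nonneg_left (infConv_le hφ ht y w) h0
  have e : (1 - r) * ‖x - w‖ ^ 2 + r * ‖y - w‖ ^ 2
      = ‖x + r • (y - x) - w‖ ^ 2 + r * (1 - r) * ‖y - x‖ ^ 2 := by
    rw [show y - w = (x - w) + (y - x) by abel,
      show x + r • (y - x) - w = (x - w) + r • (y - x) by abel,
      norm_add_sq_real, norm_add_sq_real, inner_smul_right, norm_smul, mul_pow, Real.norm_eq_abs,
      sq_abs]
    ring
  have e' : (1 - r) * (‖x - w‖ ^ 2 / (2 * t)) + r * (‖y - w‖ ^ 2 / (2 * t))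
      = ‖x + r • (y - x) - w‖ ^ 2 / (2 * t) + t⁻¹ / 2 * (r * (1 - r)) * ‖y - x‖ ^ 2 := by
    have : (1 - r) * (‖x - w‖ ^ 2 / (2 * t)) + r * (‖y - w‖ ^ 2 / (2 * t))
      = ((1 - r) * ‖x - w‖ ^ 2 + r * ‖y - w‖ ^ 2) / (2 * t) := by ring
    rw [this, e]
    field_simp
  linarith

lemma continuous_infConv [InnerProductSpace ℝ E] (hφ : ∀ x, |φ x| ≤ B) (ht : 0 < t) :
    Continuous (infConv t φ) :=
  (isSemiconcave_infConv hφ ht).continuous (inv_pos.2 ht).le (abs_infConv_le hφ ht)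

end InfConvolution

section Mollify

variable {E : Type*} [NormedAddCommGroup E] [InnerProductSpace ℝ E] [FiniteDimensional ℝ E]
  [MeasurableSpace E] [BorelSpace E]

/-- Convolution of `g` with the normalized bump function `ρ`. -/
noncomputable def mollify (ρ : ContDiffBump (0 : E)) (g : E → ℝ) (x : E) : ℝ :=
  ∫ z, ρ.normed volume z * g (x - z)

variable (ρ : ContDiffBump (0 : E)) {g g' : E → ℝ}

lemma mollify_eq_convolution :
    mollify ρ g = convolution (ρ.normed volume) g (ContinuousLinearMap.lsmul ℝ ℝ) volume := by
  ext x
  simp [mollify, convolution_def]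

lemma contDiff_mollify (hg : Continuous g) : ContDiff ℝ 1 (mollify ρ g) := by
  rw [mollify_eq_convolution]
  exact ρ.hasCompactSupport_normed.contDiff_convolution_left _
    (ρ.contDiff_normed (n := 1)) hg.locallyIntegrable

lemma integrable_normed_mul (hg : Continuous g) (x : E) :
    Integrable fun z => ρ.normed volume z * g (x - z) :=
  Continuous.integrable_of_hasCompactSupport
    (ρ.continuous_normed.mul (hg.comp (continuous_const.sub continuous_id)))
    ρ.hasCompactSupport_normed.mul_right

lemma mollify_le_mollify_add (hg : Continuous g) (hg' : Continuous g') {x x' : E} {c : ℝ}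
    (h : ∀ z, g (x - z) ≤ g' (x' - z) + c) : mollify ρ g x ≤ mollify ρ g' x' + c := by
  have e : mollify ρ g' x' + c
      = ∫ z, (ρ.normed volume z * g' (x' - z) + ρ.normed volume z * c) := by
    rw [integral_add (integrable_normed_mul ρ hg' x') (ρ.integrable_normed.mul_const c),
      integral_mul_const, ρ.integral_normed, one_mul, mollify]
  rw [e]
  refine integral_mono (integrable_normed_mul ρ hg x)
    ((integrable_normed_mul ρ hg' x').add (ρ.integrable_normed.mul_const c)) fun z => ?_
  have := mul_le_mul_of_nonneg_left (h z) (ρ.nonneg_normed (μ := volume) z)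
  dsimp only
  linarith

lemma abs_mollify_le {B : ℝ} (hg : Continuous g) (hB : ∀ x, |g x| ≤ B) (x : E) :
    |mollify ρ g x| ≤ B := by
  have h0 : mollify ρ (fun _ => 0) x = 0 := by simp [mollify]
  have h1 := mollify_le_mollify_add ρ hg (continuous_const (y := (0 : ℝ))) (x := x) (x' := x)
    (c := B) fun z => by simpa using (abs_le.1 (hB (x - z))).2
  have h2 := mollify_le_mollify_add ρ (continuous_const (y := (0 : ℝ))) hg (x := x) (x' := x)
    (c := B) fun z => by linarith [(abs_le.1 (hB (x - z))).1]
  rw [abs_le]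
  constructor <;> linarith

lemma isSemiconcave_mollify {L : ℝ} (hg : Continuous g) (h : IsSemiconcave L g) :
    IsSemiconcave L (mollify ρ g) := by
  intro x y t h0 h1
  have e : (1 - t) * mollify ρ g x + t * mollify ρ g y
      = ∫ z, ((1 - t) * (ρ.normed volume z * g (x - z))
        + t * (ρ.normed volume z * g (y - z))) := by
    rw [integral_add ((integrable_normed_mul ρ hg x).const_mul _)
      ((integrable_normed_mul ρ hg y).const_mul _), integral_const_mul, integral_const_mul,
      mollify, mollify]
  set c := L / 2 * (t * (1 - t)) * ‖y - x‖ ^ 2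
  have e' : mollify ρ g (x + t • (y - x)) + c
      = ∫ z, (ρ.normed volume z * g (x + t • (y - x) - z) + ρ.normed volume z * c) := by
    rw [integral_add (integrable_normed_mul ρ hg _) (ρ.integrable_normed.mul_const c),
      integral_mul_const, ρ.integral_normed, one_mul, mollify]
  rw [e, e']
  refine integral_mono (((integrable_normed_mul ρ hg x).const_mul _).add
      ((integrable_normed_mul ρ hg y).const_mul _))
    ((integrable_normed_mul ρ hg _).add (ρ.integrable_normed.mul_const c)) fun z => ?_
  have hz := h (x - z) (y - z) t h0 h1
  rw [sub_sub_sub_cancel_right, show x - z + t • (y - x) = x + t • (y - x) - z by abel] at hz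
  have := mul_le_mul_of_nonneg_left hz (ρ.nonneg_normed (μ := volume) z)
  simp only [c]
  linarith

lemma abs_mollify_sub_le {K : ℝ} (hK : 0 ≤ K) (hg : Continuous g)
    (hL : ∀ x y, |g x - g y| ≤ K * ‖x - y‖) (x : E) : |mollify ρ g x - g x| ≤ K * ρ.rOut := by
  rw [mollify_eq_convolution, ← Real.dist_eq]
  refine ρ.dist_normed_convolution_le hg.aestronglyMeasurable fun y hy => ?_
  rw [Real.dist_eq]
  refine (hL y x).trans ?_
  rw [← dist_eq_norm]
  gcongr
  exact (Metric.mem_ball.1 hy).le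

end Mollify

section Gradient

variable {E : Type*} [NormedAddCommGroup E] [InnerProductSpace ℝ E] [CompleteSpace E]

lemma continuous_gradient {f : E → ℝ} (hf : ContDiff ℝ 1 f) : Continuous (gradient f) :=
  (InnerProductSpace.toDual ℝ E).symm.continuous.comp (hf.continuous_fderiv one_ne_zero)

lemma IsSemiconcave.sub_smul_gradient_le {L : ℝ} {f : E → ℝ} (hs : IsSemiconcave L f)
    (hf : ContDiff ℝ 1 f) (x : E) (r : ℝ) :
    f (x - r • gradient f x) ≤ f x - r * (1 - L * r / 2) * ‖gradient f x‖ ^ 2 := by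
  have h := hs.le_add_fderiv ((hf.differentiable one_ne_zero) x) (-(r • gradient f x))
  rw [← toDual_gradient, InnerProductSpace.toDual_apply_apply, inner_neg_right, inner_smul_right,
    real_inner_self_eq_norm_sq, norm_neg, norm_smul, mul_pow, Real.norm_eq_abs, sq_abs,
    ← sub_eq_add_neg] at h
  refine h.trans (le_of_eq ?_)
  ring

lemma IsSemiconcave.norm_gradient_sq_le {L B : ℝ} {f : E → ℝ} (hs : IsSemiconcave L f)
    (hL : 0 < L) (hf : ContDiff ℝ 1 f) (hB : ∀ x, |f x| ≤ B) (x : E) :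
    ‖gradient f x‖ ^ 2 ≤ 4 * B * L := by
  have h := hs.sub_smul_gradient_le hf x L⁻¹
  rw [mul_inv_cancel₀ hL.ne'] at h
  have h1 := (abs_le.1 (hB x)).2
  have h2 := (abs_le.1 (hB (x - L⁻¹ • gradient f x))).1
  have h3 : L⁻¹ * ‖gradient f x‖ ^ 2 ≤ 4 * B := by linarith
  rwa [inv_mul_le_iff₀ hL, mul_comm] at h3

/-- One step of the mollified Hamilton-Jacobi evolution. -/
lemma mollify_infConv_add_le [FiniteDimensional ℝ E] [MeasurableSpace E] [BorelSpace E]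
    (ρ : ContDiffBump (0 : E)) {φ : E → ℝ} {B L t s : ℝ} (hφ : ∀ x, |φ x| ≤ B) (ht : 0 < t)
    (hs : 0 < s) (hL : t⁻¹ ≤ L) (x : E) :
    mollify ρ (infConv (t + s) φ) x ≤ mollify ρ (infConv t φ) x
      - s / 2 * (1 - L * s) * ‖gradient (mollify ρ (infConv t φ)) x‖ ^ 2 := by
  set f := mollify ρ (infConv t φ)
  have hf : ContDiff ℝ 1 f := contDiff_mollify ρ (continuous_infConv hφ ht)
  have hsc : IsSemiconcave L f :=
    (isSemiconcave_mollify ρ (continuous_infConv hφ ht) (isSemiconcave_infConv hφ ht)).mono hL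
  set v := gradient f x
  have h1 : mollify ρ (infConv (t + s) φ) x ≤ f (x - s • v) + s / 2 * ‖v‖ ^ 2 := by
    refine mollify_le_mollify_add ρ (continuous_infConv hφ (by positivity))
      (continuous_infConv hφ ht) fun z => ?_
    refine (infConv_add_le hφ hs ht (x - z) (x - s • v - z)).trans (le_of_eq ?_)
    rw [show x - z - (x - s • v - z) = s • v by abel, norm_smul, mul_pow, Real.norm_eq_abs, sq_abs]
    field_simp
  have h2 := hsc.sub_smul_gradient_le hf x s
  linarith

end Gradient

section Evolution

open Filter Topology

lemma integrable_of_continuous_of_abs_le {X : Type*} [TopologicalSpace X] [MeasurableSpace X]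
    [OpensMeasurableSpace X] [SecondCountableTopology X] {μ : Measure X} [IsFiniteMeasure μ]
    {f : X → ℝ} {B : ℝ} (hf : Continuous f) (hB : ∀ x, |f x| ≤ B) : Integrable f μ :=
  Integrable.of_bound hf.aestronglyMeasurable B (ae_of_all _ hB)

variable {E : Type*} [NormedAddCommGroup E] [InnerProductSpace ℝ E] [FiniteDimensional ℝ E]
  [MeasurableSpace E] [BorelSpace E]

/-- The real inequality behind one step of the discretized evolution, obtained by maximizing
a quadratic polynomial in `S`. -/
lemma interpolation_step_le {b c e h q S Δ τ N : ℝ} (hc : 0 < c) (hb : c ≤ b) (he : 0 ≤ e)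
    (hN : 0 < N) (heN : e ≤ 1 / N) (hτ : τ < 1) (hq : 0 < q) (hΔ : |Δ| ≤ h * S) :
    ((b + e) ^ 2 - b ^ 2) * Δ - b ^ 2 * ((1 - τ) / N / 2 * q * S ^ 2)
      ≤ 1 / N * ((2 + 1 / (N * c)) ^ 2 * h ^ 2 / (2 * ((1 - τ) * q))) := by
  have hb0 : 0 < b := hc.trans_le hb
  set κ := (1 - τ) * q
  have hκ : 0 < κ := mul_pos (by linarith) hq
  set w := 2 + 1 / (N * c) with hw
  have hbw : 2 * b + e ≤ b * w := by
    have h1 : 1 / N ≤ b * (1 / (N * c)) := by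
      rw [mul_one_div, div_le_div_iff₀ hN (by positivity)]
      nlinarith
    rw [hw]
    linarith
  have hhS : 0 ≤ h * S := (abs_nonneg _).trans hΔ
  have h1 : ((b + e) ^ 2 - b ^ 2) * Δ ≤ (1 / N * (b * w)) * (h * S) := by
    rw [show (b + e) ^ 2 - b ^ 2 = e * (2 * b + e) by ring]
    calc e * (2 * b + e) * Δ ≤ e * (2 * b + e) * (h * S) := by
          gcongr
          exact (le_abs_self _).trans hΔ
      _ ≤ 1 / N * (b * w) * (h * S) := by gcongr
  have h2 : b * w * (h * S) - κ * b ^ 2 * S ^ 2 / 2 ≤ w ^ 2 * h ^ 2 / (2 * κ) := by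
    rw [le_div_iff₀ (by positivity)]
    nlinarith [sq_nonneg (w * h - κ * b * S)]
  have h3 := mul_le_mul_of_nonneg_left h2 (by positivity : 0 ≤ 1 / N)
  have h4 : b ^ 2 * ((1 - τ) / N / 2 * q * S ^ 2) = 1 / N * (κ * b ^ 2 * S ^ 2 / 2) := by
    simp only [κ]
    ring
  rw [h4]
  linarith

/-- The difference of `ν` and `μ` has `Ḣ⁻¹(μ)` norm at most `h` when tested against bounded `C¹`
functions with square integrable gradient. -/
def HasGradientBound (μ ν : Measure E) (h : ℝ) : Prop :=
  ∀ f : E → ℝ, (∃ C, ∀ x, |f x| ≤ C) → ContDiff ℝ 1 f →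
    Integrable (fun x => ‖gradient f x‖ ^ 2) μ →
    |(∫ x, f x ∂ν) - ∫ x, f x ∂μ| ≤ h * √(∫ x, ‖gradient f x‖ ^ 2 ∂μ)

variable {μ ν : Measure E} [IsFiniteMeasure μ] [IsFiniteMeasure ν] {φ : E → ℝ} {B h : ℝ}

lemma abs_integral_mollify_infConv_sub_le (hφ : ∀ x, |φ x| ≤ B) {t : ℝ} (ht : 0 < t)
    (ρ : ContDiffBump (0 : E)) :
    |∫ x, mollify ρ (infConv t φ) x ∂μ - ∫ x, infConv t φ x ∂μ|
      ≤ (2 * B + t⁻¹ / 2) * ρ.rOut * μ.real Set.univ := by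
  have hc := continuous_infConv hφ ht
  have hB0 : 0 ≤ B := (abs_nonneg _).trans (hφ 0)
  rw [← integral_sub
    (integrable_of_continuous_of_abs_le (contDiff_mollify ρ hc).continuous
      (abs_mollify_le ρ hc (abs_infConv_le hφ ht)))
    (integrable_of_continuous_of_abs_le hc (abs_infConv_le hφ ht))]
  rw [← Real.norm_eq_abs]
  refine norm_integral_le_of_norm_le_const (ae_of_all _ fun x => ?_)
  exact abs_mollify_sub_le ρ (by positivity) hc
      ((isSemiconcave_infConv hφ ht).abs_sub_le (inv_pos.2 ht).le (abs_infConv_le hφ ht)) x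

/-- The discretized Hamilton-Jacobi evolution tested against interpolations of `μ` and `ν`. -/
lemma integral_mollify_infConv_one_le (hH : HasGradientBound μ ν h) (hφ : ∀ x, |φ x| ≤ B)
    (ρ : ContDiffBump (0 : E)) {c τ : ℝ} (hc : 0 < c) (hc1 : c < 1) (hτ : 0 < τ) (hτ1 : τ < 1)
    {N : ℕ} (hN : 0 < N)
    (hq : 0 < 1 - τ⁻¹ * ((1 - τ) / N)) :
    c ^ 2 * ∫ x, mollify ρ (infConv 1 φ) x ∂μ
        + (1 - c ^ 2) * ∫ x, mollify ρ (infConv 1 φ) x ∂ν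
      ≤ ∫ x, mollify ρ (infConv τ φ) x ∂μ + (2 + 1 / (N * c)) ^ 2 * h ^ 2 /
        (2 * ((1 - τ) * (1 - τ⁻¹ * ((1 - τ) / N)))) := by
  have hN' : (0 : ℝ) < N := Nat.cast_pos.2 hN
  have hs : 0 < (1 - τ) / N := div_pos (by linarith) hN'
  set s := (1 - τ) / N
  set C := (2 + 1 / (N * c)) ^ 2 * h ^ 2 / (2 * ((1 - τ) * (1 - τ⁻¹ * s)))
  let t : ℕ → ℝ := fun k => τ + k * s
  have htτ : ∀ k, τ ≤ t k := fun k => le_add_of_nonneg_right (by positivity)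
  have ht : ∀ k, 0 < t k := fun k => hτ.trans_le (htτ k)
  let f : ℕ → E → ℝ := fun k => mollify ρ (infConv (t k) φ)
  have hcd : ∀ k, ContDiff ℝ 1 (f k) := fun k => contDiff_mollify ρ (continuous_infConv hφ (ht k))
  have hfB : ∀ k x, |f k x| ≤ B := fun k =>
    abs_mollify_le ρ (continuous_infConv hφ (ht k)) (abs_infConv_le hφ (ht k))
  have hintμ : ∀ k, Integrable (f k) μ := fun k =>
    integrable_of_continuous_of_abs_le (hcd k).continuous (hfB k)
  have hintν : ∀ k, Integrable (f k) ν := fun k =>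
    integrable_of_continuous_of_abs_le (hcd k).continuous (hfB k)
  have hsc : ∀ k, IsSemiconcave τ⁻¹ (f k) := fun k =>
    (isSemiconcave_mollify ρ (continuous_infConv hφ (ht k))
      (isSemiconcave_infConv hφ (ht k))).mono (inv_anti₀ hτ (htτ k))
  have hgrad : ∀ k, Integrable (fun x => ‖gradient (f k) x‖ ^ 2) μ := fun k =>
    integrable_of_continuous_of_abs_le (B := 4 * B * τ⁻¹)
      ((continuous_gradient (hcd k)).norm.pow 2) fun x => by
        rw [abs_of_nonneg (by positivity)]
        exact (hsc k).norm_gradient_sq_le (inv_pos.2 hτ) (hcd k) (hfB k) x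
  have hpt : ∀ k x, f (k + 1) x ≤ f k x - s / 2 * (1 - τ⁻¹ * s) * ‖gradient (f k) x‖ ^ 2 := by
    intro k x
    have := mollify_infConv_add_le ρ hφ (ht k) hs (inv_anti₀ hτ (htτ k)) x
    rwa [show t k + s = t (k + 1) by simp only [t]; push_cast; ring] at this
  let b : ℕ → ℝ := fun k => 1 - (1 - c) * k / N
  let G : ℕ → ℝ := fun k => b k ^ 2 * ∫ x, f k x ∂μ + (1 - b k ^ 2) * ∫ x, f k x ∂ν
  have hstep : ∀ k, k < N → G (k + 1) ≤ G k + 1 / N * C := by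
    intro k hk
    have hkN : ((k + 1 : ℕ) : ℝ) ≤ N := by exact_mod_cast hk
    have hbc : c ≤ b (k + 1) := by
      have : (1 - c) * ((k + 1 : ℕ) : ℝ) / N ≤ 1 - c := by
        rw [div_le_iff₀ hN']
        exact mul_le_mul_of_nonneg_left hkN (by linarith)
      simp only [b]
      linarith
    have hb1 : b (k + 1) ≤ 1 := by
      have : 0 ≤ (1 - c) * ((k + 1 : ℕ) : ℝ) / N :=
        div_nonneg (mul_nonneg (by linarith) (by positivity)) hN'.le
      simp only [b]
      linarith
    have hbe : b k = b (k + 1) + (1 - c) / N := by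
      simp only [b]
      push_cast
      ring
    have hμ : ∫ x, f (k + 1) x ∂μ ≤ ∫ x, f k x ∂μ
        - s / 2 * (1 - τ⁻¹ * s) * ∫ x, ‖gradient (f k) x‖ ^ 2 ∂μ := by
      rw [← integral_const_mul, ← integral_sub (hintμ k) ((hgrad k).const_mul _)]
      exact integral_mono (hintμ _) ((hintμ k).sub ((hgrad k).const_mul _)) (hpt k)
    have hν : ∫ x, f (k + 1) x ∂ν ≤ ∫ x, f k x ∂ν := by
      refine integral_mono (hintν _) (hintν _) fun x => (hpt k x).trans ?_
      have : 0 ≤ s / 2 * (1 - τ⁻¹ * s) * ‖gradient (f k) x‖ ^ 2 := by positivity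
      linarith
    have hΔ := hH (f k) ⟨B, hfB k⟩ (hcd k) (hgrad k)
    have hA : 0 ≤ ∫ x, ‖gradient (f k) x‖ ^ 2 ∂μ := integral_nonneg fun x => by positivity
    have key := interpolation_step_le hc hbc (div_nonneg (by linarith) hN'.le : 0 ≤ (1 - c) / N) hN'
      (by gcongr; linarith) hτ1 hq hΔ
    rw [Real.sq_sqrt hA, ← hbe] at key
    have h1 := mul_le_mul_of_nonneg_left hμ (sq_nonneg (b (k + 1)))
    have h2 := mul_le_mul_of_nonneg_left hν (by nlinarith : 0 ≤ 1 - b (k + 1) ^ 2)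
    simp only [G]
    linarith
  have hind : ∀ k, k ≤ N → G k ≤ G 0 + k * (1 / N * C) := by
    intro k
    induction k with
    | zero => simp
    | succ k ih =>
      intro hk
      have := hstep k hk
      have := ih (by omega)
      push_cast
      linarith
  have hfin := hind N le_rfl
  have htN : t N = 1 := by
    simp only [t, s]
    field_simp
    ring
  have hbN : b N = c := by
    simp only [b]
    field_simp
    ring
  have hb0 : b 0 = 1 := by simp [b]
  have ht0 : t 0 = τ := by simp [t]
  simp only [G, f, htN, hbN, hb0, ht0] at hfin
  rw [← mul_assoc, mul_one_div_cancel hN'.ne'] at hfin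
  linarith

lemma integral_infConv_one_le_aux (hH : HasGradientBound μ ν h) (hφ : ∀ x, |φ x| ≤ B)
    {c τ : ℝ} (hc : 0 < c) (hc1 : c < 1) (hτ : 0 < τ) (hτ1 : τ < 1) :
    c ^ 2 * ∫ x, infConv 1 φ x ∂μ + (1 - c ^ 2) * ∫ x, infConv 1 φ x ∂ν
      ≤ ∫ x, infConv τ φ x ∂μ + 2 * h ^ 2 / (1 - τ) := by
  have hmol : ∀ N : ℕ, 0 < N → 0 < 1 - τ⁻¹ * ((1 - τ) / N) →
      c ^ 2 * ∫ x, infConv 1 φ x ∂μ + (1 - c ^ 2) * ∫ x, infConv 1 φ x ∂ν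
      ≤ ∫ x, infConv τ φ x ∂μ + (2 + 1 / (N * c)) ^ 2 * h ^ 2 /
        (2 * ((1 - τ) * (1 - τ⁻¹ * ((1 - τ) / N)))) := by
    intro N hN hq
    set C := (2 + 1 / (N * c)) ^ 2 * h ^ 2 / (2 * ((1 - τ) * (1 - τ⁻¹ * ((1 - τ) / N))))
    let F : ℝ → ℝ := fun ε => c ^ 2 * ((2 * B + 1⁻¹ / 2) * ε * μ.real Set.univ)
      + (1 - c ^ 2) * ((2 * B + 1⁻¹ / 2) * ε * ν.real Set.univ)
      + (2 * B + τ⁻¹ / 2) * ε * μ.real Set.univ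
    have hF : Tendsto (fun ε => ∫ x, infConv τ φ x ∂μ + C + F ε) (𝓝[>] 0)
        (𝓝 (∫ x, infConv τ φ x ∂μ + C + F 0)) :=
      (Continuous.tendsto (by fun_prop) _).mono_left nhdsWithin_le_nhds
    have hF0 : F 0 = 0 := by simp [F]
    rw [hF0, add_zero] at hF
    refine ge_of_tendsto hF ?_
    filter_upwards [self_mem_nhdsWithin] with ε hε
    let ρ : ContDiffBump (0 : E) := ⟨ε / 2, ε, half_pos hε, half_lt_self hε⟩
    have h0 := integral_mollify_infConv_one_le hH hφ ρ hc hc1 hτ hτ1 hN hq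
    have h1 := abs_le.1 (abs_integral_mollify_infConv_sub_le (μ := μ) hφ one_pos ρ)
    have h2 := abs_le.1 (abs_integral_mollify_infConv_sub_le (μ := ν) hφ one_pos ρ)
    have h3 := abs_le.1 (abs_integral_mollify_infConv_sub_le (μ := μ) hφ hτ ρ)
    have h4 := mul_le_mul_of_nonneg_left h1.1 (sq_nonneg c)
    have h5 := mul_le_mul_of_nonneg_left h2.1 (by nlinarith : 0 ≤ 1 - c ^ 2)
    have h6 := h3.2
    simp only [F]
    simp only [show ρ.rOut = ε from rfl] at h4 h5 h6
    linarith
  have hq : Tendsto (fun N : ℕ => 1 - τ⁻¹ * ((1 - τ) / N)) atTop (𝓝 (1 - τ⁻¹ * 0)) :=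
    ((tendsto_const_div_atTop_nhds_zero_nat _).const_mul _).const_sub _
  rw [mul_zero, sub_zero] at hq
  have hw : Tendsto (fun N : ℕ => (2 + 1 / (N * c)) ^ 2 * h ^ 2) atTop
      (𝓝 ((2 + 0) ^ 2 * h ^ 2)) := by
    refine Tendsto.mul_const _ (Tendsto.pow (Tendsto.const_add _ ?_) _)
    have := tendsto_const_div_atTop_nhds_zero_nat (c⁻¹)
    refine this.congr fun N => ?_
    rw [one_div, mul_inv, div_eq_mul_inv, mul_comm]
  have hlim := (hw.div ((hq.const_mul (1 - τ)).const_mul 2)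
    (by have : 0 < 1 - τ := by linarith
        positivity)).const_add (∫ x, infConv τ φ x ∂μ)
  have hle := ge_of_tendsto hlim (b := c ^ 2 * ∫ x, infConv 1 φ x ∂μ
    + (1 - c ^ 2) * ∫ x, infConv 1 φ x ∂ν) ?_
  · refine hle.trans (le_of_eq ?_)
    have : 1 - τ ≠ 0 := by linarith
    field_simp
    ring
  · filter_upwards [hq.eventually (lt_mem_nhds one_pos), eventually_gt_atTop 0] with N h1 h2
    exact hmol N h2 h1

/-- The dual estimate: `∫ Q₁φ dν ≤ ∫ φ dμ + 2 h²`. -/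
lemma integral_infConv_one_le (hH : HasGradientBound μ ν h) (hφc : Continuous φ)
    (hφ : ∀ x, |φ x| ≤ B) :
    ∫ x, infConv 1 φ x ∂ν ≤ ∫ x, φ x ∂μ + 2 * h ^ 2 := by
  have h1 : ∀ τ, 0 < τ → τ < 1 →
      ∫ x, infConv 1 φ x ∂ν ≤ ∫ x, φ x ∂μ + 2 * h ^ 2 / (1 - τ) := by
    intro τ hτ hτ1
    have hlim : Tendsto (fun c : ℝ => c ^ 2 * ∫ x, infConv 1 φ x ∂μ
        + (1 - c ^ 2) * ∫ x, infConv 1 φ x ∂ν) (𝓝[>] 0) (𝓝 ((0 : ℝ) ^ 2 * ∫ x, infConv 1 φ x ∂μ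
        + (1 - (0 : ℝ) ^ 2) * ∫ x, infConv 1 φ x ∂ν)) :=
      (Continuous.tendsto (by fun_prop) _).mono_left nhdsWithin_le_nhds
    have hle : ∫ x, infConv τ φ x ∂μ ≤ ∫ x, φ x ∂μ :=
      integral_mono (integrable_of_continuous_of_abs_le (continuous_infConv hφ hτ)
        (abs_infConv_le hφ hτ)) (integrable_of_continuous_of_abs_le hφc hφ) (infConv_le_self hφ hτ)
    have := le_of_tendsto hlim (b := ∫ x, infConv τ φ x ∂μ + 2 * h ^ 2 / (1 - τ)) ?_
    · linarith
    · filter_upwards [Ioo_mem_nhdsGT one_pos] with c hc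
      exact integral_infConv_one_le_aux hH hφ hc.1 hc.2 hτ hτ1
  have hlim : Tendsto (fun τ : ℝ => ∫ x, φ x ∂μ + 2 * h ^ 2 / (1 - τ)) (𝓝[>] 0)
      (𝓝 (∫ x, φ x ∂μ + 2 * h ^ 2 / (1 - 0))) := by
    refine Tendsto.mono_left ?_ nhdsWithin_le_nhds
    refine (Tendsto.div tendsto_const_nhds (tendsto_id.const_sub 1) (by norm_num)).const_add _
  rw [sub_zero, div_one] at hlim
  refine ge_of_tendsto hlim ?_
  filter_upwards [Ioo_mem_nhdsGT one_pos] with τ hτ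
  exact h1 τ hτ.1 hτ.2

lemma dual_bound (hH : HasGradientBound μ ν h) (φ ψ : BoundedContinuousFunction E ℝ) {r : ℝ}
    (hr : 0 ≤ r) (hφψ : ∀ x y, 0 ≤ φ x + ψ y + r * ‖x - y‖ ^ 2) :
    0 ≤ ∫ x, φ x ∂μ + ∫ y, ψ y ∂ν + r * (4 * h ^ 2) := by
  have hpos : ∀ s, r ≤ s → 0 < s → 0 ≤ ∫ x, φ x ∂μ + ∫ y, ψ y ∂ν + s * (4 * h ^ 2) := by
    intro s hrs hs
    have hB : ∀ x, |φ x / (2 * s)| ≤ ‖φ‖ / (2 * s) := fun x => by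
      rw [abs_div, abs_of_pos (by positivity : 0 < 2 * s)]
      gcongr
      exact φ.norm_coe_le_norm x
    have h0 := integral_infConv_one_le hH (φ.continuous.div_const (2 * s)) hB
    have h1 : ∫ y, -ψ y / (2 * s) ∂ν ≤ ∫ y, infConv 1 (fun x => φ x / (2 * s)) y ∂ν := by
      refine integral_mono ((ψ.integrable ν).neg.div_const _)
        (integrable_of_continuous_of_abs_le (continuous_infConv hB one_pos)
          (abs_infConv_le hB one_pos)) fun y => le_infConv fun w => ?_
      rw [norm_sub_rev, mul_one, div_add_div _ _ (by positivity) two_ne_zero,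
        div_le_div_iff₀ (by positivity) (by positivity)]
      have h2 : r * ‖w - y‖ ^ 2 ≤ s * ‖w - y‖ ^ 2 := by gcongr
      have h3 : 0 ≤ (φ w + ψ y + s * ‖w - y‖ ^ 2) * (4 * s) :=
        mul_nonneg (by linarith [hφψ w y]) (by positivity)
      linarith
    rw [integral_div, integral_neg] at h1
    rw [integral_div] at h0
    have h2 := h1.trans h0
    rw [div_add' _ _ _ (by positivity), div_le_div_iff_of_pos_right (by positivity)] at h2
    linarith
  have hlim : Tendsto (fun s : ℝ => ∫ x, φ x ∂μ + ∫ y, ψ y ∂ν + s * (4 * h ^ 2)) (𝓝[>] r)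
      (𝓝 (∫ x, φ x ∂μ + ∫ y, ψ y ∂ν + r * (4 * h ^ 2))) :=
    (Continuous.tendsto (by fun_prop) _).mono_left nhdsWithin_le_nhds
  refine ge_of_tendsto hlim ?_
  filter_upwards [self_mem_nhdsWithin] with s hs
  exact hpos s (Set.mem_Ioi.1 hs).le (hr.trans_lt hs)

end Evolution

section Coupling

open Filter Topology BoundedContinuousFunction CompactlySupported

/-- If `φ ⊕ ψ + s c ≥ 0` always forces `∫ φ dμ + ∫ ψ dν + s K ≥ 0`, then by Hahn-Banach there is a
linear functional with marginals at most `μ` and `ν` and cost at most `K`. -/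
lemma exists_linearMap_le_of_dual {X : Type*} [TopologicalSpace X] [MeasurableSpace X]
    [OpensMeasurableSpace X] {μ ν : Measure X} [IsFiniteMeasure μ] [IsFiniteMeasure ν]
    {c : X × X → ℝ} {K : ℝ}
    (hdual : ∀ (φ ψ : X →ᵇ ℝ) (s : ℝ), 0 ≤ s → (∀ x y, 0 ≤ φ x + ψ y + s * c (x, y)) →
      0 ≤ ∫ x, φ x ∂μ + ∫ y, ψ y ∂ν + s * K) :
    ∃ Λ : (X × X →ᵇ ℝ) →ₗ[ℝ] ℝ, ∀ (g : X × X →ᵇ ℝ) (φ ψ : X →ᵇ ℝ) (s : ℝ), 0 ≤ s →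
      (∀ x y, g (x, y) ≤ φ x + ψ y + s * c (x, y)) →
      Λ g ≤ ∫ x, φ x ∂μ + ∫ y, ψ y ∂ν + s * K := by
  let S : (X × X →ᵇ ℝ) → Set ℝ := fun g => {r | ∃ (φ ψ : X →ᵇ ℝ) (s : ℝ), 0 ≤ s ∧
    (∀ x y, g (x, y) ≤ φ x + ψ y + s * c (x, y)) ∧ r = ∫ x, φ x ∂μ + ∫ y, ψ y ∂ν + s * K}
  have hne : ∀ g, (S g).Nonempty := fun g =>
    ⟨_, const X ‖g‖, 0, 0, le_rfl, fun x y => by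
      simpa using (le_abs_self _).trans (g.norm_coe_le_norm (x, y)), rfl⟩
  have hbdd : ∀ g, BddBelow (S g) := by
    refine fun g => ⟨-(‖g‖ * μ.real Set.univ), ?_⟩
    rintro _ ⟨φ, ψ, s, hs, h, rfl⟩
    have := hdual (φ + const X ‖g‖) ψ s hs fun x y => by
      have h1 := (abs_le.1 (g.norm_coe_le_norm (x, y))).1
      have h2 := h x y
      simp only [BoundedContinuousFunction.coe_add, Pi.add_apply, const_apply]
      linarith
    simp only [BoundedContinuousFunction.coe_add, Pi.add_apply, const_apply] at this
    rw [integral_add (φ.integrable μ) (integrable_const _), integral_const, smul_eq_mul] at this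
    linarith
  have hsmul : ∀ a : ℝ, 0 < a → ∀ g, sInf (S (a • g)) ≤ a * sInf (S g) := by
    intro a ha g
    rw [← div_le_iff₀' ha]
    refine le_csInf (hne g) ?_
    rintro _ ⟨φ, ψ, s, hs, h, rfl⟩
    rw [div_le_iff₀' ha]
    refine csInf_le (hbdd _) ⟨a • φ, a • ψ, a * s, by positivity, fun x y => ?_, ?_⟩
    · have := mul_le_mul_of_nonneg_left (h x y) ha.le
      simp only [BoundedContinuousFunction.coe_smul, smul_eq_mul]
      linarith
    · simp only [BoundedContinuousFunction.coe_smul, smul_eq_mul, integral_const_mul]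
      ring
  have hadd : ∀ g g', sInf (S (g + g')) ≤ sInf (S g) + sInf (S g') := by
    intro g g'
    rw [← sub_le_iff_le_add]
    refine le_csInf (hne g) ?_
    rintro _ ⟨φ, ψ, s, hs, h, rfl⟩
    rw [sub_le_comm]
    refine le_csInf (hne g') ?_
    rintro _ ⟨φ', ψ', s', hs', h', rfl⟩
    rw [sub_le_iff_le_add]
    refine csInf_le (hbdd _) ⟨φ + φ', ψ + ψ', s + s', by positivity, fun x y => ?_, ?_⟩
    · have := h x y
      have := h' x y
      simp only [BoundedContinuousFunction.coe_add, Pi.add_apply]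
      linarith
    · simp only [BoundedContinuousFunction.coe_add, Pi.add_apply]
      rw [integral_add (φ.integrable μ) (φ'.integrable μ),
        integral_add (ψ.integrable ν) (ψ'.integrable ν)]
      ring
  obtain ⟨Λ, -, hΛ⟩ := exists_extension_of_le_sublinear
    (⟨⊥, 0⟩ : (X × X →ᵇ ℝ) →ₗ.[ℝ] ℝ) (fun g => sInf (S g))
    (fun a ha g => le_antisymm (hsmul a ha g) (by
      have := mul_le_mul_of_nonneg_left (hsmul a⁻¹ (inv_pos.2 ha) (a • g)) ha.le
      rwa [inv_smul_smul₀ ha.ne', mul_inv_cancel_left₀ ha.ne'] at this)) hadd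
    (by
      rintro ⟨g, hg⟩
      obtain rfl : g = 0 := (Submodule.mem_bot ℝ).1 hg
      refine le_csInf (hne _) ?_
      rintro _ ⟨φ, ψ, s, hs, h, rfl⟩
      exact hdual φ ψ s hs h)
  exact ⟨Λ, fun g φ ψ s hs h => (hΛ g).trans (csInf_le (hbdd g) ⟨φ, ψ, s, hs, h, rfl⟩)⟩

lemma integrable_compactlySupported {Y : Type*} [NormedAddCommGroup Y] [MeasurableSpace Y]
    [BorelSpace Y] (π : Measure Y) [IsFiniteMeasureOnCompacts π] (g : C_c(Y, ℝ)) :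
    Integrable (fun y => g y) π :=
  g.continuous.integrable_of_hasCompactSupport g.hasCompactSupport

/-- A continuous function equal to `1` on the ball of radius `k` and supported in the ball of
radius `k + 1`. -/
noncomputable def cutoff (Y : Type*) [NormedAddCommGroup Y] [ProperSpace Y] (k : ℕ) :
    C_c(Y, ℝ) where
  toFun y := max 0 (min 1 (k + 1 - ‖y‖))
  continuous_toFun := by fun_prop
  hasCompactSupport' := by
    refine HasCompactSupport.intro (isCompact_closedBall (0 : Y) (k + 1)) fun y hy => ?_
    rw [mem_closedBall_zero_iff, not_le] at hy
    exact max_eq_left ((min_le_right _ _).trans (by linarith))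

section Cutoff

variable {Y : Type*} [NormedAddCommGroup Y] [ProperSpace Y]

lemma cutoff_apply (k : ℕ) (y : Y) : cutoff Y k y = max 0 (min 1 (k + 1 - ‖y‖)) := rfl

lemma cutoff_nonneg (k : ℕ) (y : Y) : 0 ≤ cutoff Y k y := le_max_left _ _

lemma cutoff_le_one (k : ℕ) (y : Y) : cutoff Y k y ≤ 1 :=
  max_le zero_le_one (min_le_left _ _)

lemma eventually_cutoff_eq_one (y : Y) : ∀ᶠ k in atTop, cutoff Y k y = 1 := by
  filter_upwards [tendsto_natCast_atTop_atTop.eventually_ge_atTop ‖y‖] with k hk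
  rw [cutoff_apply, min_eq_left (by linarith), max_eq_right zero_le_one]

lemma cutoff_add_le (k : ℕ) (x y : Y) :
    cutoff Y k x + cutoff Y k y ≤ cutoff (Y × Y) k (x, y) + 1 := by
  have hx := cutoff_le_one k x
  have hy := cutoff_le_one k y
  rw [cutoff_apply k (x, y), Prod.norm_mk]
  rcases le_total ‖x‖ ‖y‖ with h | h
  · rw [max_eq_right h]
    change _ ≤ cutoff Y k y + 1
    linarith
  · rw [max_eq_left h]
    change _ ≤ cutoff Y k x + 1
    linarith

lemma tendsto_integral_cutoff [MeasurableSpace Y] [BorelSpace Y] (μ : Measure Y)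
    [IsFiniteMeasure μ] :
    Tendsto (fun k => ∫ y, cutoff Y k y ∂μ) atTop (𝓝 (μ.real Set.univ)) := by
  have h := tendsto_integral_of_dominated_convergence (μ := μ) (F := fun k y => cutoff Y k y)
    (f := fun _ => 1) (fun _ => 1)
    (fun k => (cutoff Y k).continuous.aestronglyMeasurable) (integrable_const _)
    (fun k => ae_of_all _ fun y => by
      rw [Real.norm_of_nonneg (cutoff_nonneg k y)]
      exact cutoff_le_one k y)
    (ae_of_all _ fun y => tendsto_const_nhds.congr' (by
      filter_upwards [eventually_cutoff_eq_one y] with k hk using hk.symm))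
  simpa using h

lemma lintegral_ofReal_le_of_forall_compactlySupported [MeasurableSpace Y] [BorelSpace Y]
    (π : Measure Y) [IsFiniteMeasureOnCompacts π] {F : Y → ℝ} (hF : Continuous F)
    (hF0 : ∀ y, 0 ≤ F y) {C : ℝ}
    (h : ∀ g : C_c(Y, ℝ), (∀ y, 0 ≤ g y) → (∀ y, g y ≤ F y) → ∫ y, g y ∂π ≤ C) :
    ∫⁻ y, ENNReal.ofReal (F y) ∂π ≤ ENNReal.ofReal C := by
  let g : ℕ → C_c(Y, ℝ) := fun k =>
    ⟨⟨fun y => cutoff Y k y * F y, (cutoff Y k).continuous.mul hF⟩,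
      (cutoff Y k).hasCompactSupport.mul_right⟩
  have hg : ∀ k y, g k y = cutoff Y k y * F y := fun _ _ => rfl
  have hg0 : ∀ k y, 0 ≤ g k y := fun k y => mul_nonneg (cutoff_nonneg k y) (hF0 y)
  have hk : ∀ k, ∫⁻ y, ENNReal.ofReal (g k y) ∂π ≤ ENNReal.ofReal C := fun k => by
    rw [← ofReal_integral_eq_lintegral_ofReal
      (integrable_compactlySupported π (g k)) (ae_of_all _ (hg0 k))]
    exact ENNReal.ofReal_le_ofReal (h _ (hg0 k) fun y =>
      mul_le_of_le_one_left (hF0 y) (cutoff_le_one k y))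
  calc ∫⁻ y, ENNReal.ofReal (F y) ∂π
      = ∫⁻ y, liminf (fun k => ENNReal.ofReal (g k y)) atTop ∂π := by
        refine lintegral_congr fun y => (Tendsto.liminf_eq ?_).symm
        refine tendsto_const_nhds.congr' ?_
        filter_upwards [eventually_cutoff_eq_one y] with k hk
        rw [hg, hk, one_mul]
    _ ≤ liminf (fun k => ∫⁻ y, ENNReal.ofReal (g k y) ∂π) atTop :=
        lintegral_liminf_le fun k => (g k).continuous.measurable.ennreal_ofReal
    _ ≤ ENNReal.ofReal C := liminf_le_of_le (by isBoundedDefault) fun b hb => by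
        obtain ⟨k, hk'⟩ := hb.exists
        exact hk'.trans (hk k)

end Cutoff

lemma eq_of_lintegral_le_of_measure_univ_eq {X : Type*} [TopologicalSpace X]
    [HasOuterApproxClosed X] [MeasurableSpace X] [BorelSpace X] {μ ρ : Measure X}
    [IsFiniteMeasure μ]
    (huniv : ρ Set.univ = μ Set.univ)
    (h : ∀ φ : X →ᵇ ℝ, (∀ x, 0 ≤ φ x) →
      ∫⁻ x, ENNReal.ofReal (φ x) ∂ρ ≤ ENNReal.ofReal (∫ x, φ x ∂μ)) : ρ = μ := by
  have : IsFiniteMeasure ρ := ⟨huniv ▸ measure_lt_top μ _⟩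
  have hle : ∀ φ : X →ᵇ ℝ, (∀ x, 0 ≤ φ x) → ∫ x, φ x ∂ρ ≤ ∫ x, φ x ∂μ := fun φ hφ => by
    rw [integral_eq_lintegral_of_nonneg_ae (ae_of_all _ hφ)
      φ.continuous.aestronglyMeasurable]
    exact ENNReal.toReal_le_of_le_ofReal (integral_nonneg hφ) (h φ hφ)
  have hle' : ∀ φ : X →ᵇ ℝ, ∫ x, φ x ∂ρ ≤ ∫ x, φ x ∂μ := fun φ => by
    have := hle (const X ‖φ‖ + φ) fun x => by
      have := (abs_le.1 (φ.norm_coe_le_norm x)).1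
      simp only [BoundedContinuousFunction.coe_add, Pi.add_apply, const_apply]
      linarith
    simp only [BoundedContinuousFunction.coe_add, Pi.add_apply, const_apply] at this
    rw [integral_add (integrable_const _) (φ.integrable _),
      integral_add (integrable_const _) (φ.integrable _), integral_const, integral_const,
      measureReal_def, measureReal_def, huniv] at this
    linarith
  refine ext_of_forall_integral_eq_of_IsFiniteMeasure fun φ => le_antisymm (hle' φ) ?_
  have := hle' (-φ)
  simp only [BoundedContinuousFunction.coe_neg, Pi.neg_apply, integral_neg] at this
  linarith

variable {X : Type*} [NormedAddCommGroup X] [ProperSpace X] [MeasurableSpace X] [BorelSpace X]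
  {μ ν : Measure X} [IsFiniteMeasure μ] [IsFiniteMeasure ν]

/-- Kantorovich duality: the dual bound `K` on the cost is attained by a coupling. -/
lemma exists_coupling_of_dual (hmass : μ Set.univ = ν Set.univ) {c : X × X → ℝ}
    (hc : Continuous c) (hc0 : ∀ p, 0 ≤ c p) {K : ℝ}
    (hdual : ∀ (φ ψ : X →ᵇ ℝ) (s : ℝ), 0 ≤ s → (∀ x y, 0 ≤ φ x + ψ y + s * c (x, y)) →
      0 ≤ ∫ x, φ x ∂μ + ∫ y, ψ y ∂ν + s * K) :
    ∃ π : Measure (X × X), π.map Prod.fst = μ ∧ π.map Prod.snd = ν ∧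
      ∫⁻ p, ENNReal.ofReal (c p) ∂π ≤ ENNReal.ofReal K := by
  obtain ⟨Λ, hΛ⟩ := exists_linearMap_le_of_dual hdual
  let T : C_c(X × X, ℝ) →ₚ[ℝ] ℝ := PositiveLinearMap.mk₀
    { toFun := fun g => Λ g.toBoundedContinuousFunction
      map_add' := fun g g' => Λ.map_add g.toBoundedContinuousFunction g'.toBoundedContinuousFunction
      map_smul' := fun a g => Λ.map_smul a g.toBoundedContinuousFunction }
    fun g hg => by
      have := hΛ (-g.toBoundedContinuousFunction) 0 0 0 le_rfl fun x y => by
        simpa using hg (x, y)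
      rw [map_neg] at this
      exact neg_nonpos.1 (this.trans_eq (by simp))
  let π := RealRMK.rieszMeasure T
  have hπ : ∀ g : C_c(X × X, ℝ), ∫ p, g p ∂π = Λ g.toBoundedContinuousFunction :=
    RealRMK.integral_rieszMeasure T
  have hle : ∀ (φ ψ : X →ᵇ ℝ) (s : ℝ), 0 ≤ s →
      (∀ x y, 0 ≤ φ x + ψ y + s * c (x, y)) →
      ∫⁻ p, ENNReal.ofReal (φ p.1 + ψ p.2 + s * c p) ∂π
        ≤ ENNReal.ofReal (∫ x, φ x ∂μ + ∫ y, ψ y ∂ν + s * K) := by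
    intro φ ψ s hs h
    refine lintegral_ofReal_le_of_forall_compactlySupported π (by fun_prop) (fun p => h p.1 p.2)
      fun g _ hg => ?_
    rw [hπ]
    exact hΛ _ φ ψ s hs fun x y => hg (x, y)
  have huniv_le : π Set.univ ≤ μ Set.univ := by
    have := hle 1 0 0 le_rfl fun x y => by simp
    simpa using this
  have : IsFiniteMeasure π := ⟨huniv_le.trans_lt (measure_lt_top μ _)⟩
  have huniv : π Set.univ = μ Set.univ := by
    refine le_antisymm huniv_le ?_
    have hk : ∀ k, ∫ x, cutoff X k x ∂μ + (∫ x, cutoff X k x ∂ν - ν.real Set.univ)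
        ≤ π.real Set.univ := by
      intro k
      have h1 := hΛ (-(cutoff (X × X) k).toBoundedContinuousFunction)
        (-(cutoff X k).toBoundedContinuousFunction)
        (const X 1 - (cutoff X k).toBoundedContinuousFunction) 0 le_rfl fun x y => by
          have := cutoff_add_le k x y
          simp
          linarith
      rw [map_neg, ← hπ] at h1
      have h2 : ∫ p, cutoff (X × X) k p ∂π ≤ ∫ _, (1 : ℝ) ∂π :=
        integral_mono (integrable_compactlySupported _ _) (integrable_const _) (cutoff_le_one k)
      have h3 : ∫ y, (1 - cutoff X k y) ∂ν = ν.real Set.univ - ∫ y, cutoff X k y ∂ν := by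
        rw [integral_sub (integrable_const _) (integrable_compactlySupported _ _)]
        simp
      simp [integral_neg, h3] at h1 h2
      linarith
    have hlim := (tendsto_integral_cutoff μ).add
      ((tendsto_integral_cutoff ν).sub_const (ν.real Set.univ))
    rw [sub_self, add_zero] at hlim
    have := le_of_tendsto' hlim hk
    exact (ENNReal.toReal_le_toReal (measure_ne_top _ _) (measure_ne_top _ _)).1 this
  refine ⟨π, ?_, ?_, ?_⟩
  · refine eq_of_lintegral_le_of_measure_univ_eq
      (by rw [Measure.map_apply measurable_fst .univ, Set.preimage_univ, huniv]) fun φ hφ => ?_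
    rw [lintegral_map φ.continuous.measurable.ennreal_ofReal measurable_fst]
    simpa using hle φ 0 0 le_rfl fun x y => by simpa using hφ x
  · refine eq_of_lintegral_le_of_measure_univ_eq
      (by rw [Measure.map_apply measurable_snd .univ, Set.preimage_univ, huniv, hmass])
      fun φ hφ => ?_
    rw [lintegral_map φ.continuous.measurable.ennreal_ofReal measurable_snd]
    simpa using hle 0 φ 0 le_rfl fun x y => by simpa using hφ y
  · simpa using hle 0 0 1 zero_le_one fun x y => by simpa using hc0 (x, y)

end Coupling

section HminusOne

variable {n : ℕ} {lam μ ν : Measure (EuclideanSpace ℝ (Fin n))}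

lemma gradient_const_mul {E : Type*} [NormedAddCommGroup E] [InnerProductSpace ℝ E]
    [CompleteSpace E] {f : E → ℝ} {x : E} (hf : DifferentiableAt ℝ f x) (a : ℝ) :
    gradient (fun y => a * f y) x = a • gradient f x := by
  rw [gradient, gradient, fderiv_const_mul hf, map_smulₛₗ, conj_trivial]

lemma abs_integral_sub_le_of_HminusOneDiff_ne_top (hfin : HminusOneDiff lam μ ν ≠ ⊤)
    {f : EuclideanSpace ℝ (Fin n) → ℝ} (hb : ∃ C, ∀ x, |f x| ≤ C) (hf : ContDiff ℝ 1 f)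
    (hint : Integrable (fun x => ‖gradient f x‖ ^ 2) lam) :
    |(∫ x, f x ∂ν) - ∫ x, f x ∂μ|
      ≤ (HminusOneDiff lam μ ν).toReal * √(∫ x, ‖gradient f x‖ ^ 2 ∂lam) := by
  set A := ∫ x, ‖gradient f x‖ ^ 2 ∂lam with hA
  have hA0 : 0 ≤ A := integral_nonneg fun x => by positivity
  have key : ∀ r, √A < r →
      |(∫ x, f x ∂ν) - ∫ x, f x ∂μ| ≤ (HminusOneDiff lam μ ν).toReal * r := by
    intro r hr
    have hr0 : 0 < r := (Real.sqrt_nonneg A).trans_lt hr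
    have hmem : (fun x => r⁻¹ * f x) ∈ {f : EuclideanSpace ℝ (Fin n) → ℝ |
        (∃ C, ∀ x, |f x| ≤ C) ∧ ContDiff ℝ 1 f ∧
        ∫⁻ x, ENNReal.ofReal (‖gradient f x‖ ^ 2) ∂lam ≤ 1} := by
      obtain ⟨C, hC⟩ := hb
      refine ⟨⟨r⁻¹ * C, fun x => ?_⟩, contDiff_const.mul hf, ?_⟩
      · rw [abs_mul, abs_of_pos (inv_pos.2 hr0)]
        exact mul_le_mul_of_nonneg_left (hC x) (inv_pos.2 hr0).le
      · have e : ∀ x, ‖gradient (fun x => r⁻¹ * f x) x‖ ^ 2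
            = (r⁻¹) ^ 2 * ‖gradient f x‖ ^ 2 := fun x => by
          rw [gradient_const_mul (hf.differentiable one_ne_zero x), norm_smul, mul_pow,
            Real.norm_eq_abs, sq_abs]
        simp only [e]
        rw [← ofReal_integral_eq_lintegral_ofReal (hint.const_mul _)
          (ae_of_all _ fun x => by positivity), integral_const_mul, ENNReal.ofReal_le_one, ← hA,
          inv_pow, inv_mul_le_iff₀ (by positivity), mul_one]
        exact (Real.sqrt_le_left hr0.le).1 hr.le
    have hle : ENNReal.ofReal |(∫ x, r⁻¹ * f x ∂ν) - ∫ x, r⁻¹ * f x ∂μ|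
        ≤ HminusOneDiff lam μ ν :=
      le_iSup₂ (f := fun (f : EuclideanSpace ℝ (Fin n) → ℝ) _ =>
        ENNReal.ofReal |(∫ x, f x ∂ν) - ∫ x, f x ∂μ|) _ hmem
    rw [ENNReal.ofReal_le_iff_le_toReal hfin, integral_const_mul, integral_const_mul, ← mul_sub,
      abs_mul, abs_of_pos (inv_pos.2 hr0), inv_mul_le_iff₀ hr0] at hle
    linarith
  refine ge_of_tendsto (x := nhdsWithin (√A) (Set.Ioi (√A)))
    (f := fun r => (HminusOneDiff lam μ ν).toReal * r)
    ((Continuous.tendsto (by fun_prop) _).mono_left nhdsWithin_le_nhds) ?_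
  filter_upwards [self_mem_nhdsWithin] with r hr
  exact key r hr

end HminusOne

/-- For finite positive Borel measures `μ, ν` on `ℝⁿ` with the same total mass,
`W₂(μ, ν) ≤ 2‖ν − μ‖_{Ḣ⁻¹(μ)}`. -/
theorem W2_le_two_mul_HminusOne {n : ℕ} (μ ν : Measure (EuclideanSpace ℝ (Fin n)))
    [IsFiniteMeasure μ] [IsFiniteMeasure ν] (hmass : μ Set.univ = ν Set.univ) :
    W2 μ ν ≤ 2 * HminusOneDiff μ μ ν := by
  by_cases hfin : HminusOneDiff μ μ ν = ⊤
  · simp [hfin]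
  set h := (HminusOneDiff μ μ ν).toReal with hh
  have h0 : 0 ≤ h := ENNReal.toReal_nonneg
  obtain ⟨π, hπ1, hπ2, hπ⟩ := exists_coupling_of_dual (μ := μ) (ν := ν) hmass
    (c := fun p => ‖p.1 - p.2‖ ^ 2) (by fun_prop) (fun p => by positivity) (K := 4 * h ^ 2)
    fun φ ψ s hs hφψ => dual_bound
      (fun f hb hf hint => abs_integral_sub_le_of_HminusOneDiff_ne_top hfin hb hf hint) φ ψ hs hφψ
  have hW : W2 μ ν ≤ ENNReal.ofReal (4 * h ^ 2) ^ (1 / 2 : ℝ) :=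
    ENNReal.rpow_le_rpow ((iInf₂_le π ⟨hπ1, hπ2⟩).trans hπ) (by norm_num)
  refine hW.trans (le_of_eq ?_)
  rw [ENNReal.ofReal_rpow_of_nonneg (by positivity) (by norm_num), ← Real.sqrt_eq_rpow,
    show 4 * h ^ 2 = (2 * h) ^ 2 by ring, Real.sqrt_sq (by positivity),
    ENNReal.ofReal_mul zero_le_two, hh, ENNReal.ofReal_toReal hfin]
  norm_num
end

section
/- Let μ and ν be finite positive Borel measures on ℝⁿ with the same total mass, and suppose μ ≤ ρ·λ and ν ≤ ρ·λ for a constant ρ > 0, where λ is Lebesgue measure on ℝⁿ. Then ‖ν − μ‖_{Ḣ⁻¹} ≤ ρ^{1/2} · W₂(μ, ν). -/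
open MeasureTheory ENNReal

open Set Filter Topology InnerProductSpace
open scoped NNReal BoundedContinuousFunction

/-- The Legendre transform of `g`, with the supremum restricted to the set `K`. -/
noncomputable def legendreOn {E : Type*} [NormedAddCommGroup E] [InnerProductSpace ℝ E]
    (K : Set E) (g : E → ℝ) (x : E) : ℝ :=
  ⨆ y : K, (⟪x, (y : E)⟫_ℝ - g y)

namespace legendreOn

variable {E : Type*} [NormedAddCommGroup E] [InnerProductSpace ℝ E]
  {K : Set E} {g h : E → ℝ} {x y : E}

theorem exists_isMax (hK : IsCompact K) (hne : K.Nonempty) (hg : Continuous g) (x : E) :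
    ∃ y ∈ K, legendreOn K g x = ⟪x, y⟫_ℝ - g y ∧
      ∀ z ∈ K, ⟪x, z⟫_ℝ - g z ≤ ⟪x, y⟫_ℝ - g y := by
  obtain ⟨y, hy, hmax⟩ := hK.exists_isMaxOn hne
    (f := fun z => ⟪x, z⟫_ℝ - g z) (by fun_prop)
  have : Nonempty K := hne.to_subtype
  refine ⟨y, hy, le_antisymm (ciSup_le fun z => hmax z.2) ?_, fun z hz => hmax hz⟩
  exact le_ciSup (f := fun z : K => ⟪x, (z : E)⟫_ℝ - g z)
    ⟨_, by rintro _ ⟨z, rfl⟩; exact hmax z.2⟩ ⟨y, hy⟩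

theorem le (hK : IsCompact K) (hg : Continuous g) (x : E) (hy : y ∈ K) :
    ⟪x, y⟫_ℝ - g y ≤ legendreOn K g x := by
  obtain ⟨z, _, h1, h2⟩ := exists_isMax hK ⟨y, hy⟩ hg x
  exact h1 ▸ h2 y hy

theorem le_add_of_forall (hK : IsCompact K) (hne : K.Nonempty) (hg : Continuous g)
    (hh : Continuous h) {c : ℝ} (hc : ∀ y ∈ K, h y - g y ≤ c) (x : E) :
    legendreOn K g x ≤ legendreOn K h x + c := by
  obtain ⟨y, hy, h1, -⟩ := exists_isMax hK hne hg x
  have := le hK hh x hy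
  linarith [hc y hy]

theorem convexOn (hK : IsCompact K) (hne : K.Nonempty) (hg : Continuous g) :
    ConvexOn ℝ univ (legendreOn K g) := by
  refine ⟨convex_univ, fun x _ x' _ a b ha hb hab => ?_⟩
  obtain ⟨y, hy, h1, -⟩ := exists_isMax hK hne hg (a • x + b • x')
  have h2 := mul_le_mul_of_nonneg_left (le hK hg x hy) ha
  have h3 := mul_le_mul_of_nonneg_left (le hK hg x' hy) hb
  rw [h1, inner_add_left, inner_smul_left, inner_smul_left]
  simp only [smul_eq_mul, conj_trivial]
  have : g y = a * g y + b * g y := by rw [← add_mul, hab, one_mul]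
  linarith

theorem lipschitzWith {R : ℝ≥0} (hK : IsCompact K) (hne : K.Nonempty)
    (hR : K ⊆ Metric.closedBall 0 R) (hg : Continuous g) :
    LipschitzWith R (legendreOn K g) := by
  refine LipschitzWith.of_le_add_mul R fun x x' => ?_
  obtain ⟨y, hy, h1, -⟩ := exists_isMax hK hne hg x
  have h2 := le hK hg x' hy
  have h3 : ⟪x - x', y⟫_ℝ ≤ R * dist x x' := by
    rw [dist_eq_norm, mul_comm]
    exact (real_inner_le_norm _ _).trans
      (mul_le_mul_of_nonneg_left (by simpa using hR hy) (norm_nonneg _))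
  rw [inner_sub_left] at h3
  linarith

theorem continuous (hK : IsCompact K) (hne : K.Nonempty) (hg : Continuous g) :
    Continuous (legendreOn K g) := by
  obtain ⟨R, hR⟩ := hK.isBounded.subset_closedBall (0 : E)
  refine (lipschitzWith (R := R.toNNReal) hK hne (hR.trans ?_) hg).continuous
  exact Metric.closedBall_subset_closedBall (Real.le_coe_toNNReal R)

theorem legendreOn_le (hK : IsCompact K) (hg : Continuous g) (hy : y ∈ K) :
    legendreOn K (legendreOn K g) y ≤ g y := by
  obtain ⟨x, -, h1, -⟩ := exists_isMax hK ⟨y, hy⟩ (continuous hK ⟨y, hy⟩ hg) y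
  have := le hK hg x hy
  rw [real_inner_comm] at this
  linarith

theorem legendreOn_legendreOn_le (hK : IsCompact K) (hg : Continuous g) (hx : x ∈ K) :
    legendreOn K (legendreOn K (legendreOn K g)) x ≤ legendreOn K g x :=
  legendreOn_le hK (continuous hK ⟨x, hx⟩ hg) hx

variable [CompleteSpace E]

theorem eq_gradient (hK : IsCompact K) (hg : Continuous g)
    (hx : DifferentiableAt ℝ (legendreOn K g) x) (hy : y ∈ K)
    (hxy : legendreOn K g x = ⟪x, y⟫_ℝ - g y) : y = gradient (legendreOn K g) x := by
  have hmin : IsLocalMin (fun z => legendreOn K g z - ⟪z, y⟫_ℝ) x :=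
    Eventually.of_forall fun z => by
      have := le hK hg z hy
      simp only [hxy]
      linarith
  have hd : HasFDerivAt (fun z => legendreOn K g z - ⟪z, y⟫_ℝ)
      (fderiv ℝ (legendreOn K g) x - innerSL ℝ y) x := by
    refine hx.hasFDerivAt.sub ?_
    simpa [real_inner_comm] using (innerSL ℝ y).hasFDerivAt (x := x)
  have h0 := hmin.hasFDerivAt_eq_zero hd
  apply ext_inner_right ℝ
  intro v
  have hv := congrArg (fun L : E →L[ℝ] ℝ => L v) h0
  simp only [sub_apply, innerSL_apply_apply,
    zero_apply] at hv
  rw [gradient, toDual_symm_apply]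
  linarith

theorem gradient_mem (hK : IsCompact K) (hne : K.Nonempty) (hg : Continuous g)
    (hx : DifferentiableAt ℝ (legendreOn K g) x) :
    gradient (legendreOn K g) x ∈ K ∧ legendreOn K g x =
      ⟪x, gradient (legendreOn K g) x⟫_ℝ - g (gradient (legendreOn K g) x) := by
  obtain ⟨y, hy, h1, -⟩ := exists_isMax hK hne hg x
  rw [← eq_gradient hK hg hx hy h1]
  exact ⟨hy, h1⟩

theorem tendsto_div (hK : IsCompact K) (hne : K.Nonempty) (hg : Continuous g)
    (h : E →ᵇ ℝ) (hx : DifferentiableAt ℝ (legendreOn K g) x) {ε : ℕ → ℝ}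
    (hε : ∀ k, 0 < ε k) (hlim : Tendsto ε atTop (𝓝 0)) :
    Tendsto (fun k => (legendreOn K (fun z => g z + ε k * h z) x - legendreOn K g x) / ε k) atTop
      (𝓝 (-h (gradient (legendreOn K g) x))) := by
  have hc : ∀ k, Continuous fun z => g z + ε k * h z := fun k => by fun_prop
  obtain ⟨hTK, hT⟩ := gradient_mem hK hne hg hx
  choose y hyK hy1 hy2 using fun k => exists_isMax hK hne (hc k) x
  have hval : Tendsto (fun k => ⟪x, y k⟫_ℝ - g (y k)) atTop (𝓝 (legendreOn K g x)) := by
    have hlow : Tendsto (fun k => legendreOn K g x - 2 * ε k * ‖h‖) atTop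
        (𝓝 (legendreOn K g x)) := by
      have := ((hlim.const_mul 2).mul_const ‖h‖).const_sub (legendreOn K g x)
      simpa using this
    refine tendsto_of_tendsto_of_tendsto_of_le_of_le hlow tendsto_const_nhds (fun k => ?_)
      fun k => le hK hg x (hyK k)
    have h1 := hy2 k _ hTK
    have h2 := mul_le_mul_of_nonneg_left (abs_le.1 (h.norm_coe_le_norm (y k))).1 (hε k).le
    have h3 := mul_le_mul_of_nonneg_left
      (abs_le.1 (h.norm_coe_le_norm (gradient (legendreOn K g) x))).2 (hε k).le
    simp only
    linarith
  have hlimy : Tendsto y atTop (𝓝 (gradient (legendreOn K g) x)) := by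
    refine hK.tendsto_nhds_of_unique_mapClusterPt (Eventually.of_forall hyK) fun z hz hcl => ?_
    refine eq_gradient hK hg hx hz ?_
    have hcont : Continuous fun z => ⟪x, z⟫_ℝ - g z := by fun_prop
    have hcl' := hcl.tendsto_comp (hcont.tendsto z)
    exact (eq_of_nhds_neBot (ClusterPt.mono hcl' hval)).symm
  refine tendsto_of_tendsto_of_tendsto_of_le_of_le tendsto_const_nhds
    ((h.continuous.tendsto _).comp hlimy).neg (fun k => ?_) fun k => ?_
  · have := le hK (hc k) x hTK
    rw [le_div_iff₀ (hε k)]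
    linarith
  · have := le hK hg x (hyK k)
    have := hy1 k
    simp only [Function.comp]
    rw [div_le_iff₀ (hε k)]
    linarith

end legendreOn

theorem integrable_of_continuous_of_ae_mem {E : Type*} [TopologicalSpace E] [T2Space E]
    [MeasurableSpace E] [OpensMeasurableSpace E] {μ : Measure E} [IsFiniteMeasure μ] {K : Set E}
    (hK : IsCompact K) (hμ : ∀ᵐ x ∂μ, x ∈ K) {g : E → ℝ} (hg : Continuous g) :
    Integrable g μ := by
  rw [← Measure.restrict_eq_self_of_ae_mem hμ]
  exact hg.continuousOn.integrableOn_compact hK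

/-- The functional minimised in the dual Kantorovich problem for the cost `(x, y) ↦ -⟪x, y⟫`. -/
noncomputable def kantorovichDual {E : Type*} [NormedAddCommGroup E] [InnerProductSpace ℝ E]
    [MeasurableSpace E] (K : Set E) (μ ν : Measure E) (g : E → ℝ) : ℝ :=
  ∫ x, legendreOn K g x ∂μ + ∫ y, g y ∂ν

namespace kantorovichDual

variable {E : Type*} [NormedAddCommGroup E] [InnerProductSpace ℝ E] [MeasurableSpace E]
  [BorelSpace E] {K : Set E} {μ ν : Measure E} [IsFiniteMeasure μ] [IsFiniteMeasure ν]
  {g h : E → ℝ}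

theorem le_add (hK : IsCompact K) (hne : K.Nonempty) (hμ : ∀ᵐ x ∂μ, x ∈ K)
    (hν : ∀ᵐ x ∂ν, x ∈ K) (hg : Continuous g) (hh : Continuous h) {a b : ℝ}
    (ha : ∀ x ∈ K, legendreOn K g x ≤ legendreOn K h x + a) (hb : ∀ y ∈ K, g y ≤ h y + b) :
    kantorovichDual K μ ν g ≤ kantorovichDual K μ ν h + (a * μ.real univ + b * ν.real univ) := by
  have hLg := integrable_of_continuous_of_ae_mem hK hμ (legendreOn.continuous hK hne hg)
  have hLh := integrable_of_continuous_of_ae_mem hK hμ (legendreOn.continuous hK hne hh)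
  have hg' := integrable_of_continuous_of_ae_mem hK hν hg
  have hh' := integrable_of_continuous_of_ae_mem hK hν hh
  have h1 : ∫ x, legendreOn K g x ∂μ ≤ ∫ x, legendreOn K h x + a ∂μ :=
    integral_mono_ae hLg (hLh.add (integrable_const a)) (by filter_upwards [hμ] using ha)
  have h2 : ∫ x, g x ∂ν ≤ ∫ x, h x + b ∂ν :=
    integral_mono_ae hg' (hh'.add (integrable_const b)) (by filter_upwards [hν] using hb)
  rw [integral_add hLh (integrable_const a), integral_const, smul_eq_mul] at h1
  rw [integral_add hh' (integrable_const b), integral_const, smul_eq_mul] at h2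
  unfold kantorovichDual
  linarith

theorem exists_minimizer (hK : IsCompact K) (hne : K.Nonempty) (hμ : ∀ᵐ x ∂μ, x ∈ K)
    (hν : ∀ᵐ x ∂ν, x ∈ K) (hmass : μ univ = ν univ) :
    ∃ g : E → ℝ, Continuous g ∧
      ∀ h : E → ℝ, Continuous h → kantorovichDual K μ ν g ≤ kantorovichDual K μ ν h := by
  obtain ⟨y₀, hy₀⟩ := hne
  have hne : K.Nonempty := ⟨y₀, hy₀⟩
  have : CompactSpace K := isCompact_iff_compactSpace.1 hK
  obtain ⟨R', hR'⟩ := hK.isBounded.subset_closedBall (0 : E)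
  obtain ⟨R, hR⟩ : ∃ R : ℝ≥0, K ⊆ Metric.closedBall 0 R :=
    ⟨R'.toNNReal, hR'.trans (Metric.closedBall_subset_closedBall (Real.le_coe_toNNReal R'))⟩
  choose ext hext using fun u : K →ᵇ ℝ =>
    u.exists_extension_norm_eq_of_isClosedEmbedding hK.isClosed.isClosedEmbedding_subtypeVal
  have hext' : ∀ u (y : K), ext u y = u y := fun u y => congrFun (hext u).2 y
  have hmono : ∀ {a b : E → ℝ}, Continuous a → Continuous b → ∀ {c : ℝ},
      (∀ y ∈ K, |a y - b y| ≤ c) → kantorovichDual K μ ν a ≤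
        kantorovichDual K μ ν b + (c * μ.real univ + c * ν.real univ) :=
    fun ha hb c hc => le_add hK hne hμ hν ha hb
      (fun x _ => legendreOn.le_add_of_forall hK hne ha hb
        (fun y hy => by linarith [(abs_le.1 (hc y hy)).1]) x)
      fun y hy => by linarith [(abs_le.1 (hc y hy)).2]
  let A : Set (K →ᵇ ℝ) := {u | LipschitzWith R u ∧ u ⟨y₀, hy₀⟩ = 0}
  have hAc : IsCompact A := by
    refine BoundedContinuousFunction.arzela_ascoli₂
      (Metric.closedBall 0 (R * Metric.diam K)) (isCompact_closedBall _ _) A ?_ ?_ ?_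
    · have : A = (⋂ (x : K) (y : K), {u : K →ᵇ ℝ | dist (u x) (u y) ≤ R * dist x y}) ∩
          {u : K →ᵇ ℝ | u ⟨y₀, hy₀⟩ = 0} := by
        ext u
        simp [A, lipschitzWith_iff_dist_le_mul]
      rw [this]
      refine IsClosed.inter (isClosed_iInter fun x => isClosed_iInter fun y => ?_) ?_
      · exact isClosed_le (by fun_prop) continuous_const
      · exact isClosed_eq (by fun_prop) continuous_const
    · rintro u x ⟨hu, hu0⟩
      have := hu.dist_le_mul x ⟨y₀, hy₀⟩
      rw [hu0] at this
      exact this.trans (mul_le_mul_of_nonneg_left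
        (Metric.dist_le_diam_of_mem hK.isBounded x.2 hy₀) R.2)
    · exact (LipschitzWith.uniformEquicontinuous _ R fun u : A => u.2.1).equicontinuous
  have hAne : A.Nonempty := ⟨0, LipschitzWith.const' 0, rfl⟩
  have hJ : Continuous fun u : K →ᵇ ℝ => kantorovichDual K μ ν (ext u) := by
    have hm : 0 ≤ μ.real univ + ν.real univ := by positivity
    refine (LipschitzWith.of_le_add_mul (μ.real univ + ν.real univ).toNNReal
      fun u v => ?_).continuous
    have := hmono (ext u).continuous (ext v).continuous (c := dist u v) fun y hy => by
      rw [hext' u ⟨y, hy⟩, hext' v ⟨y, hy⟩]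
      exact BoundedContinuousFunction.dist_coe_le_dist (f := u) (g := v) _
    rw [Real.coe_toNNReal _ hm]
    linarith
  obtain ⟨u₀, -, hu₀⟩ := hAc.exists_isMinOn hAne hJ.continuousOn
  refine ⟨ext u₀, (ext u₀).continuous, fun h hh => ?_⟩
  have hLh := legendreOn.continuous hK hne hh
  have hp := legendreOn.continuous hK hne hLh
  set p := legendreOn K (legendreOn K h) with hp_def
  have hq : Continuous fun y => p y - p y₀ := by fun_prop
  let u : K →ᵇ ℝ := BoundedContinuousFunction.mkOfCompact
    ⟨fun y => p y - p y₀, hq.comp continuous_subtype_val⟩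
  have hu : u ∈ A := by
    refine ⟨LipschitzWith.of_dist_le_mul fun x y => ?_, sub_self _⟩
    have := (legendreOn.lipschitzWith hK hne hR hLh).dist_le_mul x y
    simpa [u, Real.dist_eq, Subtype.dist_eq, hp_def] using this
  calc kantorovichDual K μ ν (ext u₀)
      ≤ kantorovichDual K μ ν (ext u) := hu₀ hu
    _ ≤ kantorovichDual K μ ν (fun y => p y - p y₀) + (0 * μ.real univ + 0 * ν.real univ) :=
        hmono (ext u).continuous hq fun y hy => by
          rw [hext' u ⟨y, hy⟩]
          simp [u]
    _ = kantorovichDual K μ ν (fun y => p y - p y₀) := by ring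
    _ ≤ kantorovichDual K μ ν h + (p y₀ * μ.real univ + (-p y₀) * ν.real univ) := by
        refine le_add hK hne hμ hν hq hh (fun x hx => ?_) fun y hy => ?_
        · have h1 := legendreOn.le_add_of_forall hK hne hq hp (c := p y₀)
            (fun y _ => by linarith) x
          linarith [legendreOn.legendreOn_legendreOn_le hK hh hx]
        · linarith [legendreOn.legendreOn_le hK hh hy]
    _ = kantorovichDual K μ ν h := by
        simp only [measureReal_def, hmass]
        ring

end kantorovichDual

section Brenier

variable {E : Type*} [NormedAddCommGroup E] [InnerProductSpace ℝ E] [CompleteSpace E]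
  [MeasurableSpace E] [BorelSpace E]

theorem measurable_gradient (f : E → ℝ) : Measurable (gradient f) :=
  (toDual ℝ E).symm.continuous.measurable.comp (measurable_fderiv ℝ f)

variable {K : Set E} {μ ν : Measure E} [IsFiniteMeasure μ] [IsFiniteMeasure ν] {g : E → ℝ}

theorem integral_comp_gradient_le_of_minimizer (hK : IsCompact K) (hne : K.Nonempty)
    (hμ : ∀ᵐ x ∂μ, x ∈ K) (hν : ∀ᵐ x ∂ν, x ∈ K) (hg : Continuous g)
    (hmin : ∀ h : E → ℝ, Continuous h → kantorovichDual K μ ν g ≤ kantorovichDual K μ ν h)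
    (hd : ∀ᵐ x ∂μ, DifferentiableAt ℝ (legendreOn K g) x) (h : E →ᵇ ℝ) :
    ∫ x, h (gradient (legendreOn K g) x) ∂μ ≤ ∫ y, h y ∂ν := by
  let ε : ℕ → ℝ := fun k => 1 / (k + 1)
  have hε : ∀ k, 0 < ε k := fun k => by positivity
  have hc : ∀ k, Continuous fun z => g z + ε k * h z := fun k => by fun_prop
  have hL := legendreOn.continuous hK hne hg
  have hLk := fun k => legendreOn.continuous hK hne (hc k)
  have hlim : Tendsto
      (fun k => ∫ x, (legendreOn K (fun z => g z + ε k * h z) x - legendreOn K g x) / ε k ∂μ) atTop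
      (𝓝 (∫ x, -h (gradient (legendreOn K g) x) ∂μ)) := by
    refine tendsto_integral_of_dominated_convergence (fun _ => ‖h‖)
      (fun k => (((hLk k).sub hL).div_const _).measurable.aestronglyMeasurable)
      (integrable_const _) (fun k => Eventually.of_forall fun x => ?_) ?_
    · have hb : ∀ y, |ε k * h y| ≤ ε k * ‖h‖ := fun y => by
        rw [abs_mul, abs_of_pos (hε k)]
        exact mul_le_mul_of_nonneg_left (h.norm_coe_le_norm y) (hε k).le
      have h1 := legendreOn.le_add_of_forall hK hne hg (hc k) (c := ε k * ‖h‖)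
        (fun y _ => by linarith [(abs_le.1 (hb y)).2]) x
      have h2 := legendreOn.le_add_of_forall hK hne (hc k) hg (c := ε k * ‖h‖)
        (fun y _ => by linarith [(abs_le.1 (hb y)).1]) x
      rw [norm_div, Real.norm_eq_abs, Real.norm_eq_abs, abs_of_pos (hε k), div_le_iff₀ (hε k),
        abs_le]
      constructor <;> linarith
    · filter_upwards [hd] with x hx
      exact legendreOn.tendsto_div hK hne hg h hx hε tendsto_one_div_add_atTop_nhds_zero_nat
  have hnonneg : ∀ k, -∫ y, h y ∂ν ≤
      ∫ x, (legendreOn K (fun z => g z + ε k * h z) x - legendreOn K g x) / ε k ∂μ := fun k => by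
    have h1 := hmin _ (hc k)
    unfold kantorovichDual at h1
    rw [integral_add (integrable_of_continuous_of_ae_mem hK hν hg)
      (integrable_of_continuous_of_ae_mem hK hν (by fun_prop)), integral_const_mul] at h1
    rw [integral_div, integral_sub (integrable_of_continuous_of_ae_mem hK hμ (hLk k))
      (integrable_of_continuous_of_ae_mem hK hμ hL), le_div_iff₀ (hε k)]
    linarith
  have := ge_of_tendsto' hlim hnonneg
  rw [integral_neg] at this
  linarith

theorem map_gradient_eq_of_minimizer (hK : IsCompact K) (hne : K.Nonempty)
    (hμ : ∀ᵐ x ∂μ, x ∈ K) (hν : ∀ᵐ x ∂ν, x ∈ K) (hg : Continuous g)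
    (hmin : ∀ h : E → ℝ, Continuous h → kantorovichDual K μ ν g ≤ kantorovichDual K μ ν h)
    (hd : ∀ᵐ x ∂μ, DifferentiableAt ℝ (legendreOn K g) x) :
    μ.map (gradient (legendreOn K g)) = ν := by
  refine ext_of_forall_integral_eq_of_IsFiniteMeasure fun h => ?_
  rw [integral_map (measurable_gradient _).aemeasurable
    h.continuous.measurable.aestronglyMeasurable]
  have h1 := integral_comp_gradient_le_of_minimizer hK hne hμ hν hg hmin hd h
  have h2 := integral_comp_gradient_le_of_minimizer hK hne hμ hν hg hmin hd (-h)
  simp only [BoundedContinuousFunction.coe_neg, Pi.neg_apply, integral_neg] at h2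
  linarith

theorem lintegral_gradient_le_of_coupling [SecondCountableTopology E] (hK : IsCompact K)
    (hne : K.Nonempty) (hμ : ∀ᵐ x ∂μ, x ∈ K) (hν : ∀ᵐ x ∂ν, x ∈ K) (hg : Continuous g)
    (hd : ∀ᵐ x ∂μ, DifferentiableAt ℝ (legendreOn K g) x)
    (hmap : μ.map (gradient (legendreOn K g)) = ν) {π : Measure (E × E)}
    (hπ₁ : π.map Prod.fst = μ) (hπ₂ : π.map Prod.snd = ν) :
    ∫⁻ x, ENNReal.ofReal (‖x - gradient (legendreOn K g) x‖ ^ 2) ∂μ ≤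
      ∫⁻ p, ENNReal.ofReal (‖p.1 - p.2‖ ^ 2) ∂π := by
  have hL := legendreOn.continuous hK hne hg
  let a : E → ℝ := fun x => ‖x‖ ^ 2 - 2 * legendreOn K g x
  let b : E → ℝ := fun y => ‖y‖ ^ 2 - 2 * g y
  have hca : Continuous a := by fun_prop
  have hcb : Continuous b := by fun_prop
  have ha : Integrable a μ := integrable_of_continuous_of_ae_mem hK hμ hca
  have hb : Integrable b ν := integrable_of_continuous_of_ae_mem hK hν hcb
  have hT := measurable_gradient (legendreOn K g)
  have hbT : Integrable (fun x => b (gradient (legendreOn K g) x)) μ := by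
    rw [← hmap] at hb
    exact (integrable_map_measure hcb.measurable.aestronglyMeasurable hT.aemeasurable).1 hb
  have heq : ∀ᵐ x ∂μ, ‖x - gradient (legendreOn K g) x‖ ^ 2 =
      a x + b (gradient (legendreOn K g) x) := by
    filter_upwards [hd] with x hx
    have := (legendreOn.gradient_mem hK hne hg hx).2
    rw [norm_sub_sq_real]
    simp only [a, b]
    linarith
  have hπK₁ : ∀ᵐ p ∂π, p.1 ∈ K := ae_of_ae_map measurable_fst.aemeasurable (hπ₁ ▸ hμ)
  have hπK₂ : ∀ᵐ p ∂π, p.2 ∈ K := ae_of_ae_map measurable_snd.aemeasurable (hπ₂ ▸ hν)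
  have : IsFiniteMeasure (π.map Prod.fst) := hπ₁ ▸ inferInstance
  have : IsFiniteMeasure π := Measure.isFiniteMeasure_of_map measurable_fst.aemeasurable
  have hcost : Integrable (fun p : E × E => ‖p.1 - p.2‖ ^ 2) π :=
    integrable_of_continuous_of_ae_mem (hK.prod hK)
      (by filter_upwards [hπK₁, hπK₂] with p h1 h2 using ⟨h1, h2⟩) (by fun_prop)
  have haπ : Integrable (fun p : E × E => a p.1) π := by
    rw [← hπ₁] at ha
    exact (integrable_map_measure hca.measurable.aestronglyMeasurable
      measurable_fst.aemeasurable).1 ha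
  have hbπ : Integrable (fun p : E × E => b p.2) π := by
    rw [← hπ₂] at hb
    exact (integrable_map_measure hcb.measurable.aestronglyMeasurable
      measurable_snd.aemeasurable).1 hb
  calc ∫⁻ x, ENNReal.ofReal (‖x - gradient (legendreOn K g) x‖ ^ 2) ∂μ
      = ∫⁻ x, ENNReal.ofReal (a x + b (gradient (legendreOn K g) x)) ∂μ := by
        refine lintegral_congr_ae ?_
        filter_upwards [heq] with x hx
        rw [hx]
    _ = ENNReal.ofReal (∫ x, a x + b (gradient (legendreOn K g) x) ∂μ) := by
        refine (ofReal_integral_eq_lintegral_ofReal (ha.add hbT) ?_).symm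
        filter_upwards [heq] with x hx
        simp only [Pi.zero_apply, Pi.add_apply, ← hx]
        positivity
    _ = ENNReal.ofReal (∫ p, a p.1 + b p.2 ∂π) := by
        rw [integral_add ha hbT, integral_add haπ hbπ,
          ← integral_map hT.aemeasurable hcb.measurable.aestronglyMeasurable,
          ← integral_map (φ := Prod.fst) measurable_fst.aemeasurable
            hca.measurable.aestronglyMeasurable,
          ← integral_map (φ := Prod.snd) measurable_snd.aemeasurable
            hcb.measurable.aestronglyMeasurable, hmap, hπ₁, hπ₂]
    _ ≤ ENNReal.ofReal (∫ p, ‖p.1 - p.2‖ ^ 2 ∂π) := by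
        refine ENNReal.ofReal_le_ofReal (integral_mono_ae (haπ.add hbπ) hcost ?_)
        filter_upwards [hπK₂] with p hp
        have := legendreOn.le hK hg p.1 hp
        simp only [norm_sub_sq_real, a, b]
        linarith
    _ = ∫⁻ p, ENNReal.ofReal (‖p.1 - p.2‖ ^ 2) ∂π :=
        ofReal_integral_eq_lintegral_ofReal hcost (Eventually.of_forall fun p => by positivity)

end Brenier

/-- `y` is a subgradient of the function `φ` at the point `x`. -/
def IsSubgradientAt {E : Type*} [NormedAddCommGroup E] [InnerProductSpace ℝ E]
    (φ : E → ℝ) (y x : E) : Prop :=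
  ∀ z, φ x + ⟪y, z - x⟫_ℝ ≤ φ z

/-- **Brenier's theorem**: the optimal transport for the quadratic cost from an absolutely
continuous measure, between finite measures carried by a compact set, is a map whose values are
subgradients of a convex function. -/
theorem exists_subgradient_transport {E : Type*} [NormedAddCommGroup E]
    [InnerProductSpace ℝ E] [FiniteDimensional ℝ E] [MeasurableSpace E] [BorelSpace E]
    {lam μ ν : Measure E} [lam.IsAddHaarMeasure] [IsFiniteMeasure μ] [IsFiniteMeasure ν]
    {K : Set E} (hK : IsCompact K) (hne : K.Nonempty) (hμ : ∀ᵐ x ∂μ, x ∈ K)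
    (hν : ∀ᵐ x ∂ν, x ∈ K) (hmass : μ univ = ν univ) (hac : μ ≪ lam) :
    ∃ (φ : E → ℝ) (T : E → E) (C : ℝ≥0), LipschitzWith C φ ∧ ConvexOn ℝ univ φ ∧ Measurable T ∧
      (∀ᵐ x ∂μ, IsSubgradientAt φ (T x) x) ∧ μ.map T = ν ∧
      ∀ π : Measure (E × E), π.map Prod.fst = μ → π.map Prod.snd = ν →
        ∫⁻ x, ENNReal.ofReal (‖x - T x‖ ^ 2) ∂μ ≤ ∫⁻ p, ENNReal.ofReal (‖p.1 - p.2‖ ^ 2) ∂π := by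
  obtain ⟨g, hg, hmin⟩ := kantorovichDual.exists_minimizer hK hne hμ hν hmass
  obtain ⟨R, hR⟩ := hK.isBounded.subset_closedBall (0 : E)
  have hLip := legendreOn.lipschitzWith (R := R.toNNReal) hK hne
    (hR.trans (Metric.closedBall_subset_closedBall (Real.le_coe_toNNReal R))) hg
  have hd : ∀ᵐ x ∂μ, DifferentiableAt ℝ (legendreOn K g) x :=
    hac.ae_le (hLip.ae_differentiableAt (μ := lam))
  have hmap := map_gradient_eq_of_minimizer hK hne hμ hν hg hmin hd
  refine ⟨_, gradient (legendreOn K g), _, hLip, legendreOn.convexOn hK hne hg,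
    measurable_gradient _, ?_, hmap,
    fun π => lintegral_gradient_le_of_coupling hK hne hμ hν hg hd hmap⟩
  filter_upwards [hd] with x hx z
  obtain ⟨hTK, hT⟩ := legendreOn.gradient_mem hK hne hg hx
  have := legendreOn.le hK hg z hTK
  rw [inner_sub_right, real_inner_comm, real_inner_comm x]
  linarith

namespace LinearMap

variable {E : Type*} [NormedAddCommGroup E] [InnerProductSpace ℝ E] [FiniteDimensional ℝ E]

theorem IsSymmetric.abs_det_le_one_or_abs_det_le_one {A B : E →ₗ[ℝ] E} (hA : A.IsSymmetric)
    (hA0 : ∀ x, 0 ≤ ⟪x, A x⟫_ℝ) (hB0 : ∀ x, 0 ≤ ⟪x, B x⟫_ℝ) {t : ℝ} (ht0 : 0 < t) (ht1 : t < 1)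
    (hAB : ∀ x, x = (1 - t) • A x + t • B x) : |LinearMap.det A| ≤ 1 ∨ |LinearMap.det B| ≤ 1 := by
  let v := hA.eigenvectorBasis rfl
  let a := hA.eigenvalues rfl
  let b := fun i => (1 - (1 - t) * a i) / t
  have hAv : ∀ i, A (v i) = a i • v i := hA.apply_eigenvectorBasis rfl
  have hBv : ∀ i, B (v i) = b i • v i := fun i => by
    have h := hAB (v i)
    rw [hAv] at h
    have : t • B (v i) = t • (b i • v i) := by
      rw [smul_smul, mul_div_cancel₀ _ ht0.ne', sub_smul, one_smul, mul_smul]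
      exact eq_sub_of_add_eq' h.symm
    exact smul_right_injective E ht0.ne' this
  have hinner : ∀ (c : ℝ) i, ⟪v i, c • v i⟫_ℝ = c := fun c i => by
    rw [inner_smul_right, real_inner_self_eq_norm_sq, v.norm_eq_one]
    simp
  have ha0 : ∀ i, 0 ≤ a i := fun i => by
    have := hA0 (v i)
    rwa [hAv, hinner] at this
  have hb0 : ∀ i, 0 ≤ b i := fun i => by
    have := hB0 (v i)
    rwa [hBv, hinner] at this
  have hdetA : LinearMap.det A = ∏ i, a i := hA.det_eq_prod_eigenvalues rfl
  have hdetB : LinearMap.det B = ∏ i, b i := by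
    rw [← LinearMap.det_toMatrix v.toBasis, show LinearMap.toMatrix v.toBasis v.toBasis B =
      Matrix.diagonal b from ?_, Matrix.det_diagonal]
    ext i j
    rw [LinearMap.toMatrix_apply, OrthonormalBasis.coe_toBasis, hBv, map_smul,
      ← OrthonormalBasis.coe_toBasis, Module.Basis.repr_self, Matrix.diagonal_apply]
    by_cases hij : i = j <;> simp [hij]
  have hpA : 0 ≤ ∏ i, a i := Finset.prod_nonneg fun i _ => ha0 i
  have hpB : 0 ≤ ∏ i, b i := Finset.prod_nonneg fun i _ => hb0 i
  rw [hdetA, hdetB, abs_of_nonneg hpA, abs_of_nonneg hpB]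
  by_contra! hcon
  have hle : (∏ i, a i) ^ (1 - t) * (∏ i, b i) ^ t ≤ 1 := by
    rw [← Real.finsetProd_rpow _ _ fun i _ => ha0 i, ← Real.finsetProd_rpow _ _ fun i _ => hb0 i,
      ← Finset.prod_mul_distrib]
    refine Finset.prod_le_one (fun i _ => mul_nonneg (Real.rpow_nonneg (ha0 i) _)
      (Real.rpow_nonneg (hb0 i) _)) fun i _ => ?_
    refine (Real.geom_mean_le_arith_mean2_weighted (by linarith) ht0.le (ha0 i) (hb0 i)
      (by ring)).trans (le_of_eq ?_)
    simp only [b]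
    field_simp
    ring
  have h1 := Real.one_lt_rpow hcon.1 (sub_pos.2 ht1)
  have h2 := Real.one_lt_rpow hcon.2 ht0
  nlinarith

end LinearMap

namespace LipschitzWith

variable {E : Type*} [NormedAddCommGroup E] [InnerProductSpace ℝ E] [FiniteDimensional ℝ E]
  [MeasurableSpace E] [BorelSpace E]

open Module in
theorem addHaar_image_eq_zero (lam : Measure E) [lam.IsAddHaarMeasure] {f : E → E} {C : ℝ≥0}
    (hf : LipschitzWith C f) {s : Set E} (hs : lam s = 0) : lam (f '' s) = 0 := by
  have := isAddHaarMeasure_hausdorffMeasure (E := E)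
  have h1 : μH[finrank ℝ E] ≪ lam := Measure.absolutelyContinuous_isAddHaarMeasure _ _
  have h2 : lam ≪ μH[finrank ℝ E] := Measure.absolutelyContinuous_isAddHaarMeasure _ _
  refine h2 (le_antisymm ?_ bot_le)
  refine (hf.hausdorffMeasure_image_le (Nat.cast_nonneg _) s).trans ?_
  rw [h1 hs, mul_zero]

end LipschitzWith

section Interpolation

variable {E : Type*} [NormedAddCommGroup E] [InnerProductSpace ℝ E] {φ : E → ℝ} {t : ℝ}
  {X Y : E → E}

theorem IsSubgradientAt.inner_nonneg {x x' y y' : E} (h : IsSubgradientAt φ y x)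
    (h' : IsSubgradientAt φ y' x') : 0 ≤ ⟪y - y', x - x'⟫_ℝ := by
  have h1 := h x'
  have h2 := h' x
  simp only [inner_sub_left, inner_sub_right] at *
  linarith

theorem IsSubgradientAt.mul_norm_sq_le {x x' y y' : E} (ht0 : 0 ≤ t) (ht1 : t ≤ 1)
    (h : IsSubgradientAt φ y x) (h' : IsSubgradientAt φ y' x') :
    (1 - t) * ‖x - x'‖ ^ 2 ≤ ⟪((1 - t) • x + t • y) - ((1 - t) • x' + t • y'), x - x'⟫_ℝ ∧
      t * ‖y - y'‖ ^ 2 ≤ ⟪((1 - t) • x + t • y) - ((1 - t) • x' + t • y'), y - y'⟫_ℝ := by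
  have h0 := h.inner_nonneg h'
  have e : ((1 - t) • x + t • y) - ((1 - t) • x' + t • y') =
      (1 - t) • (x - x') + t • (y - y') := by module
  rw [e, inner_add_left, inner_add_left]
  simp only [real_inner_smul_left, real_inner_self_eq_norm_sq]
  rw [real_inner_comm (y - y') (x - x')]
  have h1 := mul_nonneg ht0 h0
  have h2 := mul_nonneg (sub_nonneg.2 ht1) h0
  constructor <;> linarith

theorem ConvexOn.exists_prox [FiniteDimensional ℝ E] {C : ℝ≥0} (hφ : ConvexOn ℝ univ φ)
    (hC : LipschitzWith C φ) (ht0 : 0 < t) (ht1 : t < 1) (z : E) :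
    ∃ x y, z = (1 - t) • x + t • y ∧ IsSubgradientAt φ y x := by
  have hs : 0 < 1 - t := by linarith
  obtain ⟨x, hx⟩ : ∃ x, ∀ x', (1 - t) / 2 * ‖x‖ ^ 2 + t * φ x - ⟪z, x⟫_ℝ ≤
      (1 - t) / 2 * ‖x'‖ ^ 2 + t * φ x' - ⟪z, x'⟫_ℝ := by
    have := hC.continuous
    refine Continuous.exists_forall_le' (by fun_prop) 0 ?_
    filter_upwards [(tendsto_norm_cocompact_atTop (E := E)).eventually_ge_atTop
      (2 * (t * C + ‖z‖) / (1 - t))] with x hx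
    have h1 := (abs_le.1 ((Real.dist_eq _ _).symm.trans_le (hC.dist_le_mul x 0))).1
    have h2 := real_inner_le_norm z x
    rw [dist_zero_right] at h1
    rw [div_le_iff₀ hs] at hx
    have h3 := mul_le_mul_of_nonneg_right hx (norm_nonneg x)
    have h4 := mul_le_mul_of_nonneg_left h1 ht0.le
    simp only [norm_zero, inner_zero_right]
    nlinarith
  refine ⟨x, t⁻¹ • (z - (1 - t) • x), ?_, fun x' => ?_⟩
  · rw [smul_smul, mul_inv_cancel₀ ht0.ne', one_smul]
    module
  have key : ∀ s : ℝ, 0 < s → s ≤ 1 →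
      0 ≤ t * (φ x' - φ x) - ⟪z - (1 - t) • x, x' - x⟫_ℝ + s * ((1 - t) / 2 * ‖x' - x‖ ^ 2) := by
    intro s hs0 hs1
    have h1 := hx (x + s • (x' - x))
    have h2 := hφ.2 (mem_univ x) (mem_univ x') (sub_nonneg.2 hs1) hs0.le (by ring)
    rw [show (1 - s) • x + s • x' = x + s • (x' - x) by module] at h2
    simp only [smul_eq_mul] at h2
    have h3 := mul_le_mul_of_nonneg_left h2 ht0.le
    rw [norm_add_sq_real, norm_smul, inner_add_right, real_inner_smul_right,
      real_inner_smul_right, mul_pow, Real.norm_eq_abs, sq_abs] at h1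
    rw [inner_sub_left, real_inner_smul_left]
    refine nonneg_of_mul_nonneg_right ?_ hs0
    nlinarith
  have hlim : Tendsto (fun s : ℝ => t * (φ x' - φ x) - ⟪z - (1 - t) • x, x' - x⟫_ℝ +
      s * ((1 - t) / 2 * ‖x' - x‖ ^ 2)) (𝓝[>] 0)
      (𝓝 (t * (φ x' - φ x) - ⟪z - (1 - t) • x, x' - x⟫_ℝ +
        0 * ((1 - t) / 2 * ‖x' - x‖ ^ 2))) :=
    (Continuous.tendsto (by fun_prop) 0).mono_left nhdsWithin_le_nhds
  have h0 := ge_of_tendsto hlim (by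
    filter_upwards [Ioc_mem_nhdsGT (zero_lt_one' ℝ)] with s h using key s h.1 h.2)
  rw [zero_mul, add_zero] at h0
  rw [real_inner_smul_left]
  have : t * (t⁻¹ * ⟪z - (1 - t) • x, x' - x⟫_ℝ) = ⟪z - (1 - t) • x, x' - x⟫_ℝ := by
    field_simp
  refine le_of_mul_le_mul_left ?_ ht0
  linarith

theorem lipschitzWith_of_mul_norm_sq_le_inner {c : ℝ} (hc : 0 < c)
    (h : ∀ z z', c * ‖X z - X z'‖ ^ 2 ≤ ⟪z - z', X z - X z'⟫_ℝ) :
    LipschitzWith (Real.toNNReal c⁻¹) X := by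
  refine LipschitzWith.of_dist_le_mul fun z z' => ?_
  rw [dist_eq_norm, dist_eq_norm, Real.coe_toNNReal _ (inv_nonneg.2 hc.le), inv_mul_eq_div,
    le_div_iff₀ hc]
  have h1 := (h z z').trans (real_inner_le_norm _ _)
  rcases (norm_nonneg (X z - X z')).eq_or_lt with h0 | h0
  · rw [← h0, zero_mul]
    positivity
  · refine le_of_mul_le_mul_right ?_ h0
    linarith

theorem inner_fderiv_nonneg {z : E} {A : E →L[ℝ] E} (hA : HasFDerivAt X A z)
    (h : ∀ z z', 0 ≤ ⟪z - z', X z - X z'⟫_ℝ) (v : E) : 0 ≤ ⟪v, A v⟫_ℝ := by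
  have h1 := hA.lim v (c := fun s : ℝ => s) (l := atTop) tendsto_norm_atTop_atTop
  refine ge_of_tendsto (tendsto_const_nhds.inner h1) ?_
  filter_upwards [eventually_gt_atTop 0] with c hc
  have h2 := h (z + c⁻¹ • v) z
  rw [add_sub_cancel_left, real_inner_smul_left] at h2
  rw [real_inner_smul_right]
  exact mul_nonneg hc.le (nonneg_of_mul_nonneg_right h2 (inv_pos.2 hc))

theorem hasFDerivAt_envelope (ht0 : 0 < t) (ht1 : t < 1)
    (hXY : ∀ z, z = (1 - t) • X z + t • Y z) (hsub : ∀ z, IsSubgradientAt φ (Y z) (X z)) (z : E) :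
    HasFDerivAt (fun z => ⟪z, X z⟫_ℝ - (1 - t) / 2 * ‖X z‖ ^ 2 - t * φ (X z))
      (innerSL ℝ (X z)) z := by
  set M : E → ℝ := fun z => ⟪z, X z⟫_ℝ - (1 - t) / 2 * ‖X z‖ ^ 2 - t * φ (X z) with hM
  have hs : 0 < 1 - t := by linarith
  have hsup : ∀ z z', ⟪z', X z⟫_ℝ - (1 - t) / 2 * ‖X z‖ ^ 2 - t * φ (X z) ≤ M z' := by
    intro z z'
    have h1 := mul_le_mul_of_nonneg_left (hsub z' (X z)) ht0.le
    have h2 := mul_nonneg hs.le (sq_nonneg ‖X z' - X z‖)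
    have h3 : ∀ w, ⟪z', w⟫_ℝ = (1 - t) * ⟪X z', w⟫_ℝ + t * ⟪Y z', w⟫_ℝ := fun w => by
      conv_lhs => rw [hXY z', inner_add_left, real_inner_smul_left, real_inner_smul_left]
    rw [norm_sub_sq_real] at h2
    rw [inner_sub_right] at h1
    simp only [hM, h3, real_inner_self_eq_norm_sq]
    linarith
  have hLip : LipschitzWith (Real.toNNReal (1 - t)⁻¹) X :=
    lipschitzWith_of_mul_norm_sq_le_inner hs fun z z' => by
      simpa only [← hXY] using ((hsub z).mul_norm_sq_le ht0.le ht1.le (hsub z')).1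
  have hO : (fun z' => M z' - M z - ⟪X z, z' - z⟫_ℝ) =O[𝓝 z] fun z' => ‖z' - z‖ ^ 2 := by
    refine Asymptotics.IsBigO.of_bound (1 - t)⁻¹ (Eventually.of_forall fun z' => ?_)
    have h1 := hsup z z'
    have h2 := hsup z' z
    have h3 := hLip.dist_le_mul z' z
    rw [dist_eq_norm, dist_eq_norm, Real.coe_toNNReal _ (inv_nonneg.2 hs.le)] at h3
    have h4 := (real_inner_le_norm (z' - z) (X z' - X z)).trans
      (mul_le_mul_of_nonneg_left h3 (norm_nonneg _))
    rw [norm_pow, norm_norm, Real.norm_eq_abs, real_inner_comm, inner_sub_left,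
      abs_of_nonneg (by simp only [hM] at *; linarith)]
    simp only [inner_sub_left, inner_sub_right] at h4
    simp only [hM] at *
    linarith
  have h0 := hO.hasFDerivAt (𝕜 := ℝ) one_lt_two
  have h1 := (h0.add (innerSL ℝ (X z)).hasFDerivAt).add_const (M z - ⟪X z, z⟫_ℝ)
  rw [zero_add] at h1
  convert! h1 using 1
  ext z'
  simp only [Pi.add_apply, innerSL_apply_apply, inner_sub_right]
  ring

theorem isSymmetric_fderiv_of_hasFDerivAt_innerSL {M : E → ℝ}
    (hM : ∀ z, HasFDerivAt M (innerSL ℝ (X z)) z) {z : E} {A : E →L[ℝ] E}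
    (hA : HasFDerivAt X A z) : (A : E →ₗ[ℝ] E).IsSymmetric := by
  let J : E →L[ℝ] E →L[ℝ] ℝ := innerSL ℝ
  have h1 : HasFDerivAt (fun z => J (X z)) (J.comp A) z := J.hasFDerivAt.comp z hA
  intro v w
  have : ⟪A v, w⟫_ℝ = ⟪A w, v⟫_ℝ := second_derivative_symmetric (𝕜 := ℝ) hM h1 v w
  exact this.trans (real_inner_comm _ _)

end Interpolation

section Density

theorem measure_preimage_le_of_leftInverse_ae {α β : Type*} [MeasurableSpace α]
    [MeasurableSpace β] {μ : Measure α} {κ : Measure β} {R : α → β} {S : α → α} {W : α → β}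
    (hR : Measurable R) (hle : μ.map R ≤ κ) (hW : ∀ᵐ x ∂μ, W (S x) = R x) (P : Set α) :
    μ (S ⁻¹' P) ≤ κ (W '' P) := by
  calc μ (S ⁻¹' P) ≤ μ (R ⁻¹' toMeasurable κ (W '' P)) := by
        refine measure_mono_ae ?_
        filter_upwards [hW] with x hx hxP
        exact subset_toMeasurable _ _ (hx ▸ mem_image_of_mem W hxP)
    _ = μ.map R (toMeasurable κ (W '' P)) :=
        (Measure.map_apply hR (measurableSet_toMeasurable _ _)).symm
    _ ≤ κ (toMeasurable κ (W '' P)) := hle _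
    _ = κ (W '' P) := measure_toMeasurable _

variable {E : Type*} [NormedAddCommGroup E] [InnerProductSpace ℝ E] [FiniteDimensional ℝ E]
  [MeasurableSpace E] [BorelSpace E] {lam μ ν : Measure E} [lam.IsAddHaarMeasure]

theorem addHaar_image_le_of_abs_det_fderiv_le_one {W : E → E} {P : Set E} (hP : MeasurableSet P)
    (hd : ∀ z ∈ P, DifferentiableAt ℝ W z) (hdet : ∀ z ∈ P, |(fderiv ℝ W z).det| ≤ 1) :
    lam (W '' P) ≤ lam P :=
  calc lam (W '' P) ≤ ∫⁻ z in P, ENNReal.ofReal |(fderiv ℝ W z).det| ∂lam :=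
        addHaar_image_le_lintegral_abs_det_fderiv lam hP
          fun z hz => (hd z hz).hasFDerivAt.hasFDerivWithinAt
    _ ≤ ∫⁻ _ in P, 1 ∂lam :=
        setLIntegral_mono' hP fun z hz => ENNReal.ofReal_le_one.2 (hdet z hz)
    _ = lam P := setLIntegral_one P

/-- The density bound is preserved along the displacement interpolation. -/
theorem map_interpolation_le {φ : E → ℝ} {T : E → E} {C : ℝ≥0} {c : ℝ≥0∞} {t : ℝ}
    (hC : LipschitzWith C φ) (hφ : ConvexOn ℝ univ φ) (hT : Measurable T)
    (hsub : ∀ᵐ x ∂μ, IsSubgradientAt φ (T x) x) (hmap : μ.map T = ν)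
    (hμ : μ ≤ c • lam) (hν : ν ≤ c • lam) (ht0 : 0 < t) (ht1 : t < 1) :
    μ.map (fun x => (1 - t) • x + t • T x) ≤ c • lam := by
  have hs : 0 < 1 - t := by linarith
  choose X Y hXY hsubXY using fun z => hφ.exists_prox hC ht0 ht1 z
  have hmono := fun z z' => (hsubXY z).mul_norm_sq_le ht0.le ht1.le (hsubXY z')
  simp only [← hXY] at hmono
  have hX := lipschitzWith_of_mul_norm_sq_le_inner hs fun z z' => (hmono z z').1
  have hY := lipschitzWith_of_mul_norm_sq_le_inner ht0 fun z z' => (hmono z z').2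
  set S : E → E := fun x => (1 - t) • x + t • T x with hS
  have hSm : Measurable S := by fun_prop
  have hXS : ∀ᵐ x ∂μ, X (S x) = x := by
    filter_upwards [hsub] with x hx
    have h1 := (hx.mul_norm_sq_le ht0.le ht1.le (hsubXY (S x))).1
    rw [← hXY, sub_self, inner_zero_left] at h1
    have h2 : ‖x - X (S x)‖ ^ 2 = 0 :=
      le_antisymm (nonpos_of_mul_nonpos_right h1 hs) (sq_nonneg _)
    exact (sub_eq_zero.1 (norm_eq_zero.1 (pow_eq_zero_iff two_ne_zero |>.1 h2))).symm
  have hYS : ∀ᵐ x ∂μ, Y (S x) = T x := by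
    filter_upwards [hXS] with x hx
    have h1 := hXY (S x)
    rw [hx] at h1
    exact (smul_right_injective E ht0.ne' (add_left_cancel h1)).symm
  have hPX := measure_preimage_le_of_leftInverse_ae (W := X) measurable_id
    ((Measure.map_id (μ := μ)).symm ▸ hμ) hXS
  have hPY := measure_preimage_le_of_leftInverse_ae (W := Y) hT (hmap.symm ▸ hν) hYS
  have hdet : ∀ z, DifferentiableAt ℝ X z → DifferentiableAt ℝ Y z →
      |(fderiv ℝ X z).det| ≤ 1 ∨ |(fderiv ℝ Y z).det| ≤ 1 := by
    intro z hXz hYz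
    refine LinearMap.IsSymmetric.abs_det_le_one_or_abs_det_le_one (t := t)
      (isSymmetric_fderiv_of_hasFDerivAt_innerSL
        (hasFDerivAt_envelope ht0 ht1 hXY hsubXY) hXz.hasFDerivAt)
      (inner_fderiv_nonneg hXz.hasFDerivAt fun z z' => ?_)
      (inner_fderiv_nonneg hYz.hasFDerivAt fun z z' => ?_) ht0 ht1 fun v => ?_
    · exact le_trans (by positivity) (hmono z z').1
    · exact le_trans (by positivity) (hmono z z').2
    · have h1 := (hXz.hasFDerivAt.const_smul (1 - t)).add (hYz.hasFDerivAt.const_smul t)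
      have h2 : HasFDerivAt (fun z : E => z) ((1 - t) • fderiv ℝ X z + t • fderiv ℝ Y z) z := by
        convert! h1 using 1
        funext z
        exact hXY z
      exact DFunLike.congr_fun ((hasFDerivAt_id z).unique h2) v
  refine Measure.le_iff.2 fun P hP => ?_
  rw [Measure.map_apply hSm hP]
  let D : Set E := {z | DifferentiableAt ℝ X z} ∩ {z | DifferentiableAt ℝ Y z}
  have hD : MeasurableSet D :=
    (measurableSet_of_differentiableAt ℝ X).inter (measurableSet_of_differentiableAt ℝ Y)
  have hDnull : lam Dᶜ = 0 := by
    have : ∀ᵐ z ∂lam, z ∈ D := by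
      filter_upwards [hX.ae_differentiableAt, hY.ae_differentiableAt] with z h1 h2 using ⟨h1, h2⟩
    exact this
  let V : Set E := {z | |(fderiv ℝ X z).det| ≤ 1}
  have hV : MeasurableSet V :=
    measurableSet_le (ContinuousLinearMap.continuous_det.measurable.comp
      (measurable_fderiv ℝ X)).abs measurable_const
  have h1 : μ (S ⁻¹' (P ∩ D ∩ V)) ≤ c * lam (P ∩ D ∩ V) :=
    (hPX _).trans <| mul_le_mul_right (addHaar_image_le_of_abs_det_fderiv_le_one
      ((hP.inter hD).inter hV) (fun z hz => hz.1.2.1) fun z hz => hz.2) c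
  have h2 : μ (S ⁻¹' ((P ∩ D) \ V)) ≤ c * lam ((P ∩ D) \ V) :=
    (hPY _).trans <| mul_le_mul_right (addHaar_image_le_of_abs_det_fderiv_le_one
      ((hP.inter hD).diff hV) (fun z hz => hz.1.2.2)
      fun z hz => (hdet z hz.1.2.1 hz.1.2.2).resolve_left hz.2) c
  have h3 : μ (S ⁻¹' (P \ D)) = 0 := by
    refine le_antisymm ((hPX _).trans ?_) zero_le
    rw [Measure.smul_apply, hX.addHaar_image_eq_zero lam
      (measure_mono_null (fun z hz => hz.2) hDnull), smul_zero]
  calc μ (S ⁻¹' P)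
      ≤ μ (S ⁻¹' (P ∩ D ∩ V)) + μ (S ⁻¹' ((P ∩ D) \ V)) + μ (S ⁻¹' (P \ D)) := by
        rw [← measure_inter_add_sdiff (S ⁻¹' P) (hSm hD),
          ← measure_inter_add_sdiff (S ⁻¹' P ∩ S ⁻¹' D) (hSm hV)]
        rfl
    _ ≤ c * lam (P ∩ D ∩ V) + c * lam ((P ∩ D) \ V) := by
        rw [h3, add_zero]
        exact add_le_add h1 h2
    _ = c * lam (P ∩ D) := by
        rw [← mul_add, measure_inter_add_sdiff _ hV]
    _ ≤ (c • lam) P := mul_le_mul_right (measure_mono inter_subset_left) c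

end Density

theorem ContDiff.enorm_sub_le_lintegral_segment {E : Type*} [NormedAddCommGroup E]
    [NormedSpace ℝ E] {f : E → ℝ} (hf : ContDiff ℝ 1 f) (x y : E) :
    ‖f y - f x‖ₑ ≤ ∫⁻ t in Ioo (0 : ℝ) 1, ‖fderiv ℝ f ((1 - t) • x + t • y)‖ₑ * ‖x - y‖ₑ := by
  have hd : ∀ t : ℝ, HasDerivAt (fun t : ℝ => f ((1 - t) • x + t • y))
      (fderiv ℝ f ((1 - t) • x + t • y) (y - x)) t := fun t => by
    have h1 : HasDerivAt (fun t : ℝ => (1 - t) • x + t • y) (y - x) t := by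
      have := (((hasDerivAt_id t).const_sub 1).smul_const x).add ((hasDerivAt_id t).smul_const y)
      convert! this using 1
      module
    exact ((hf.differentiable one_ne_zero _).hasFDerivAt).comp_hasDerivAt t h1
  have hc : Continuous fun t : ℝ => fderiv ℝ f ((1 - t) • x + t • y) :=
    (hf.continuous_fderiv one_ne_zero).comp (by fun_prop)
  have h1 := intervalIntegral.integral_eq_sub_of_hasDerivAt (a := 0) (b := 1)
    (fun t _ => hd t) ((hc.clm_apply continuous_const).intervalIntegrable _ _)
  simp only [sub_self, zero_smul, one_smul, zero_add, sub_zero, add_zero] at h1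
  rw [← h1, intervalIntegral.integral_of_le zero_le_one, integral_Ioc_eq_integral_Ioo]
  refine (enorm_integral_le_lintegral_enorm _).trans (lintegral_mono fun t => ?_)
  rw [← enorm_neg (x - y), neg_sub]
  exact ContinuousLinearMap.le_opENorm _ _

section Bound

variable {E : Type*} [NormedAddCommGroup E] [InnerProductSpace ℝ E] [FiniteDimensional ℝ E]
  [MeasurableSpace E] [BorelSpace E] {lam : Measure E} {f : E → ℝ} {c : ℝ≥0∞}

theorem ofReal_abs_integral_sub_le_of_isCompact [lam.IsAddHaarMeasure]
    (hf : ContDiff ℝ 1 f) (hf1 : ∫⁻ x, ‖fderiv ℝ f x‖ₑ ^ 2 ∂lam ≤ 1)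
    {K : Set E} (hK : IsCompact K) (hne : K.Nonempty) {π : Measure (E × E)} [IsFiniteMeasure π]
    (hπ : ∀ᵐ p ∂π, p.1 ∈ K ∧ p.2 ∈ K) (hfst : π.map Prod.fst ≤ c • lam)
    (hsnd : π.map Prod.snd ≤ c • lam) :
    ENNReal.ofReal |∫ p, (f p.2 - f p.1) ∂π| ≤
      c ^ (1 / 2 : ℝ) * (∫⁻ p, ENNReal.ofReal (‖p.1 - p.2‖ ^ 2) ∂π) ^ (1 / 2 : ℝ) := by
  have hKm := hK.measurableSet
  have hμ : ∀ᵐ x ∂π.map Prod.fst, x ∈ K :=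
    (ae_map_iff measurable_fst.aemeasurable hKm).2 (hπ.mono fun p h => h.1)
  have hν : ∀ᵐ x ∂π.map Prod.snd, x ∈ K :=
    (ae_map_iff measurable_snd.aemeasurable hKm).2 (hπ.mono fun p h => h.2)
  obtain ⟨φ, T, C, hC, hφ, hT, hsub, hmap, hcost⟩ := exists_subgradient_transport (lam := lam)
    hK hne hμ hν
    (by rw [Measure.map_apply measurable_fst .univ, Measure.map_apply measurable_snd .univ]; rfl)
    (Measure.absolutelyContinuous_of_le_smul hfst)
  have hint₁ := integrable_of_continuous_of_ae_mem hK hμ hf.continuous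
  have hint₂ := integrable_of_continuous_of_ae_mem hK hν hf.continuous
  have hfm := hf.continuous.measurable.aestronglyMeasurable (μ := π.map Prod.fst)
  have hfm' := hf.continuous.measurable.aestronglyMeasurable (μ := π.map Prod.snd)
  have hfmT := hf.continuous.measurable.aestronglyMeasurable (μ := (π.map Prod.fst).map T)
  have heq : ∫ p, (f p.2 - f p.1) ∂π = ∫ x, (f (T x) - f x) ∂π.map Prod.fst := by
    have h1 : Integrable (fun p => f p.1) π :=
      (integrable_map_measure hfm measurable_fst.aemeasurable).1 hint₁
    have h2 : Integrable (fun p => f p.2) π :=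
      (integrable_map_measure hfm' measurable_snd.aemeasurable).1 hint₂
    have h3 : Integrable (fun x => f (T x)) (π.map Prod.fst) :=
      (integrable_map_measure hfmT hT.aemeasurable).1 (hmap.symm ▸ hint₂)
    rw [integral_sub h2 h1, integral_sub h3 hint₁,
      ← integral_map measurable_snd.aemeasurable hfm',
      ← integral_map measurable_fst.aemeasurable hfm, ← integral_map hT.aemeasurable hfmT, hmap]
  have hcf : Continuous fun x => ‖fderiv ℝ f x‖ₑ := (hf.continuous_fderiv one_ne_zero).enorm
  have hSm : Measurable fun q : E × ℝ => (1 - q.2) • q.1 + q.2 • T q.1 := by fun_prop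
  have hslice : ∀ t ∈ Ioo (0 : ℝ) 1,
      ∫⁻ x, ‖fderiv ℝ f ((1 - t) • x + t • T x)‖ₑ * ‖x - T x‖ₑ ∂π.map Prod.fst ≤
        c ^ (1 / 2 : ℝ) *
          (∫⁻ p, ENNReal.ofReal (‖p.1 - p.2‖ ^ 2) ∂π) ^ (1 / 2 : ℝ) := by
    intro t ht
    have hS : Measurable fun x : E => (1 - t) • x + t • T x := by fun_prop
    refine (ENNReal.lintegral_mul_le_Lp_mul_Lq _ Real.HolderConjugate.two_two
      (hcf.measurable.comp hS).aemeasurable (by fun_prop)).trans ?_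
    refine mul_le_mul' (ENNReal.rpow_le_rpow ?_ (by norm_num))
      (ENNReal.rpow_le_rpow ?_ (by norm_num))
    · simp only [ENNReal.rpow_two, Function.comp_apply]
      rw [← lintegral_map (f := fun x => ‖fderiv ℝ f x‖ₑ ^ 2) (hcf.measurable.pow_const 2) hS]
      refine (lintegral_mono' (map_interpolation_le hC hφ hT hsub hmap hfst hsnd ht.1 ht.2)
        le_rfl).trans ?_
      rw [lintegral_smul_measure]
      exact mul_le_of_le_one_right' hf1
    · refine le_trans (le_of_eq (lintegral_congr fun x => ?_)) (hcost π rfl rfl)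
      rw [ENNReal.rpow_two, ← ofReal_norm, ENNReal.ofReal_pow (norm_nonneg _)]
  calc ENNReal.ofReal |∫ p, (f p.2 - f p.1) ∂π|
      = ‖∫ x, (f (T x) - f x) ∂π.map Prod.fst‖ₑ := by
        rw [heq, ← Real.norm_eq_abs, ofReal_norm]
    _ ≤ ∫⁻ x, ‖f (T x) - f x‖ₑ ∂π.map Prod.fst := enorm_integral_le_lintegral_enorm _
    _ ≤ ∫⁻ x, (∫⁻ t in Ioo (0 : ℝ) 1,
          ‖fderiv ℝ f ((1 - t) • x + t • T x)‖ₑ * ‖x - T x‖ₑ) ∂π.map Prod.fst :=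
        lintegral_mono fun x => hf.enorm_sub_le_lintegral_segment x (T x)
    _ = ∫⁻ t in Ioo (0 : ℝ) 1,
          ∫⁻ x, ‖fderiv ℝ f ((1 - t) • x + t • T x)‖ₑ * ‖x - T x‖ₑ ∂π.map Prod.fst :=
        lintegral_lintegral_swap ((hcf.measurable.comp hSm).mul (by fun_prop)).aemeasurable
    _ ≤ ∫⁻ _ in Ioo (0 : ℝ) 1, c ^ (1 / 2 : ℝ) *
          (∫⁻ p, ENNReal.ofReal (‖p.1 - p.2‖ ^ 2) ∂π) ^ (1 / 2 : ℝ) :=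
        setLIntegral_mono' measurableSet_Ioo hslice
    _ = _ := by simp

theorem ofReal_abs_integral_sub_le_of_coupling [lam.IsAddHaarMeasure]
    (hf : ContDiff ℝ 1 f) (hf1 : ∫⁻ x, ‖fderiv ℝ f x‖ₑ ^ 2 ∂lam ≤ 1)
    {π : Measure (E × E)} [IsFiniteMeasure π] (hint : Integrable (fun p => f p.2 - f p.1) π)
    (hfst : π.map Prod.fst ≤ c • lam) (hsnd : π.map Prod.snd ≤ c • lam) :
    ENNReal.ofReal |∫ p, (f p.2 - f p.1) ∂π| ≤
      c ^ (1 / 2 : ℝ) * (∫⁻ p, ENNReal.ofReal (‖p.1 - p.2‖ ^ 2) ∂π) ^ (1 / 2 : ℝ) := by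
  let B : ℕ → Set (E × E) := fun R => Metric.closedBall 0 R
  have hB : ∀ R, MeasurableSet (B R) := fun R => Metric.isClosed_closedBall.measurableSet
  have hlim : Tendsto (fun R => ∫ p in B R, (f p.2 - f p.1) ∂π) atTop
      (𝓝 (∫ p, (f p.2 - f p.1) ∂π)) := by
    have := tendsto_setIntegral_of_monotone hB
      (fun m n h => Metric.closedBall_subset_closedBall (Nat.cast_le.2 h)) hint.integrableOn
    rwa [Metric.iUnion_closedBall_nat, setIntegral_univ] at this
  refine le_of_tendsto ((ENNReal.continuous_ofReal.tendsto _).comp hlim.abs)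
    (Eventually.of_forall fun R => ?_)
  refine (ofReal_abs_integral_sub_le_of_isCompact hf hf1 (isCompact_closedBall (0 : E) R)
    ⟨0, by simp⟩ ?_ ((Measure.map_mono Measure.restrict_le_self measurable_fst).trans hfst)
    ((Measure.map_mono Measure.restrict_le_self measurable_snd).trans hsnd)).trans ?_
  · filter_upwards [ae_restrict_mem (hB R)] with p hp
    simpa [B, Prod.norm_def] using hp
  · gcongr
    exact Measure.restrict_le_self

end Bound

/-- If `μ ≤ ρ·λ` and `ν ≤ ρ·λ` with `ρ > 0` and `μ, ν` are finite measures with the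
same total mass, then `‖ν − μ‖_{Ḣ⁻¹} ≤ √ρ · W₂(μ, ν)`. -/
theorem HminusOne_le_W2_of_upperDensityBound {n : ℕ}
    (μ ν : Measure (EuclideanSpace ℝ (Fin n)))
    [IsFiniteMeasure μ] [IsFiniteMeasure ν] (hmass : μ Set.univ = ν Set.univ)
    (ρ : ℝ) (hρ : 0 < ρ)
    (hμ : μ ≤ ENNReal.ofReal ρ • volume) (hν : ν ≤ ENNReal.ofReal ρ • volume) :
    HminusOneDiff volume μ ν ≤ ENNReal.ofReal (Real.sqrt ρ) * W2 μ ν := by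
  refine iSup₂_le fun f ⟨⟨b, hb⟩, hf, hf1⟩ => ?_
  have hfm := hf.continuous.measurable
  have hgrad : ∫⁻ x, ‖fderiv ℝ f x‖ₑ ^ 2 ≤ 1 := by
    refine le_trans (le_of_eq (lintegral_congr fun x => ?_)) hf1
    rw [ENNReal.ofReal_pow (norm_nonneg _), ← ofReal_norm, gradient,
      LinearIsometryEquiv.norm_map]
  have hsqrt : ENNReal.ofReal ρ ^ (1 / 2 : ℝ) = ENNReal.ofReal (Real.sqrt ρ) := by
    rw [ENNReal.ofReal_rpow_of_pos hρ, Real.sqrt_eq_rpow]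
  have h0 : ENNReal.ofReal (Real.sqrt ρ) ≠ 0 := by simpa using hρ
  rw [mul_comm, ← ENNReal.div_le_iff h0 ENNReal.ofReal_ne_top, W2, one_div,
    ENNReal.le_rpow_inv_iff two_pos]
  refine le_iInf₂ fun π ⟨h1, h2⟩ => ?_
  have : IsFiniteMeasure (π.map Prod.fst) := h1 ▸ inferInstance
  have : IsFiniteMeasure π := Measure.isFiniteMeasure_of_map measurable_fst.aemeasurable
  rw [← ENNReal.le_rpow_inv_iff two_pos, ENNReal.div_le_iff h0 ENNReal.ofReal_ne_top, mul_comm,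
    ← hsqrt, ← one_div, ← h1, ← h2, integral_map measurable_fst.aemeasurable
      hfm.aestronglyMeasurable, integral_map measurable_snd.aemeasurable hfm.aestronglyMeasurable]
  have hi₁ : Integrable (fun p => f p.1) π :=
    Integrable.of_bound (hfm.comp measurable_fst).aestronglyMeasurable b
      (Eventually.of_forall fun p => hb p.1)
  have hi₂ : Integrable (fun p => f p.2) π :=
    Integrable.of_bound (hfm.comp measurable_snd).aestronglyMeasurable b
      (Eventually.of_forall fun p => hb p.2)
  rw [← integral_sub hi₂ hi₁]
  exact ofReal_abs_integral_sub_le_of_coupling hf hgrad (hi₂.sub hi₁) (h1 ▸ hμ) (h2 ▸ hν)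
end
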